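/- arXiv:math/0406243 — 2 statements merged into one kernel-verified Lean document; each statement's English description precedes it below -/
import Mathlib

section
/- Let K be an algebraically closed field and A a commutative K-algebra that is finite-dimensional as a K-vector space. Then A is reduced if and only if the number of K-algebra homomorphisms A → K equals dim_K A. -/
/-- An element of a finite-dimensional commutative algebra over an algebraically closed field that
is killed by every algebra homomorphism to the base field is nilpotent. -/
theorem isNilpotent_of_forall_algHom_eq_zero
    {K A : Type*} [Field K] [IsAlgClosed K] [CommRing A] [Algebra K A]
    [FiniteDimensional K A] {x : A} (hx : ∀ φ : A →ₐ[K] K, φ x = 0) : IsNilpotent x := by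
  rw [← mem_nilradical, nilradical_eq_sInf, Submodule.mem_sInf]
  intro P (hP : Ideal.IsPrime P)
  have : IsArtinianRing A := IsArtinianRing.of_finite K A
  have : Ideal.IsMaximal P := inferInstance
  let _ : Field (A ⧸ P) := Ideal.Quotient.field P
  let ψ : (A ⧸ P) →ₐ[K] K := IsAlgClosed.lift
  have h : ψ (Ideal.Quotient.mk P x) = 0 := hx (ψ.comp (Ideal.Quotient.mkₐ K P))
  exact Ideal.Quotient.eq_zero_iff_mem.mp ((map_eq_zero ψ).mp h)

/-- Let `K` be an algebraically closed field and `A` a commutative `K`-algebra that is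
finite-dimensional as a `K`-vector space.  Then `A` is reduced if and only if the number of
`K`-algebra homomorphisms `A → K` equals `dim_K A`. -/
theorem isReduced_iff_card_algHom_eq_finrank
    {K A : Type*} [Field K] [IsAlgClosed K] [CommRing A] [Algebra K A]
    [FiniteDimensional K A] :
    IsReduced A ↔ Nat.card (A →ₐ[K] K) = Module.finrank K A := by
  have := Fintype.ofFinite (A →ₐ[K] K)
  constructor
  · intro hA
    refine (card_algHom_le_finrank K A K).antisymm ?_
    let ev : A →ₗ[K] (A →ₐ[K] K) → K := LinearMap.pi fun φ ↦ φ.toLinearMap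
    have hev : Function.Injective ev := by
      rw [injective_iff_map_eq_zero]
      exact fun x hx ↦ (isNilpotent_of_forall_algHom_eq_zero fun φ ↦ congr_fun hx φ).eq_zero
    simpa using LinearMap.finrank_le_finrank_of_injective hev
  · intro hcard
    have hspan : Submodule.span K (Set.range (AlgHom.toLinearMap : (A →ₐ[K] K) → A →ₗ[K] K)) = ⊤ :=
      (linearIndependent_algHom_toLinearMap K A K).span_eq_top_of_card_eq_finrank'
        (by rw [← Nat.card_eq_fintype_card, hcard]; exact Subspace.dual_finrank_eq.symm)
    refine ⟨fun x hx ↦ (Module.forall_dual_apply_eq_zero_iff K x).mp fun f ↦ ?_⟩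
    have hf : f ∈ Submodule.span K (Set.range (AlgHom.toLinearMap : (A →ₐ[K] K) → A →ₗ[K] K)) :=
      hspan ▸ Submodule.mem_top
    induction hf using Submodule.span_induction with
    | mem f hf =>
      obtain ⟨φ, rfl⟩ := hf
      exact (hx.map φ).eq_zero
    | zero => rfl
    | add f g _ _ hf hg => simp [hf, hg]
    | smul c f _ hf => simp [hf]
end

section
/- Let p be an odd prime and k = 2m an even integer with k ≥ 4. Then the dimension of the space of holomorphic cusp forms of weight k for Γ_0(p) equals the dimension of the space of cusp forms of weight m(p+1) for SL_2(ℤ) plus the dimension of the space of cusp forms of weight m(p+1) − (p−1) for SL_2(ℤ): dim S_k(Γ_0(p)) = dim S_{m(p+1)}(SL_2(ℤ)) + dim S_{m(p+1)−(p−1)}(SL_2(ℤ)). -/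
open CongruenceSubgroup

section LevelOneAndPrimeLevel

open UpperHalfPlane ModularForm Filter Topology
open scoped MatrixGroups Manifold ModularForm

/-- Functions on the upper half plane that are modular forms of weight `k` for `Γ ≤ SL(2, ℤ)`. -/
def modFun (Γ : Subgroup SL(2, ℤ)) (k : ℤ) : Submodule ℂ (ℍ → ℂ) where
  carrier := {f | MDiff f ∧ (∀ γ ∈ Γ, f ∣[k] γ = f) ∧
    ∀ γ : SL(2, ℤ), IsBoundedAtImInfty (f ∣[k] γ)}
  zero_mem' := ⟨mdifferentiable_const, fun γ _ ↦ SlashAction.zero_slash _ _, fun γ ↦ by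
    rw [SlashAction.zero_slash]; exact zero_form_isBoundedAtImInfty⟩
  add_mem' := by
    rintro f g ⟨hf, hf', hf''⟩ ⟨hg, hg', hg''⟩
    refine ⟨hf.add hg, fun γ hγ ↦ ?_, fun γ ↦ ?_⟩
    · rw [SlashAction.add_slash, hf' γ hγ, hg' γ hγ]
    · rw [SlashAction.add_slash]; exact (hf'' γ).add (hg'' γ)
  smul_mem' := by
    rintro c f ⟨hf, hf', hf''⟩
    refine ⟨hf.const_smul c, fun γ hγ ↦ ?_, fun γ ↦ ?_⟩
    · rw [SL_smul_slash, hf' γ hγ]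
    · rw [SL_smul_slash]
      exact (hf'' γ).const_mul_left c

/-- Functions on the upper half plane that are cusp forms of weight `k` for `Γ ≤ SL(2, ℤ)`. -/
def cuspFun (Γ : Subgroup SL(2, ℤ)) (k : ℤ) : Submodule ℂ (ℍ → ℂ) where
  carrier := {f | MDiff f ∧ (∀ γ ∈ Γ, f ∣[k] γ = f) ∧
    ∀ γ : SL(2, ℤ), IsZeroAtImInfty (f ∣[k] γ)}
  zero_mem' := ⟨mdifferentiable_const, fun γ _ ↦ SlashAction.zero_slash _ _, fun γ ↦ by
    rw [SlashAction.zero_slash]; exact tendsto_const_nhds⟩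
  add_mem' := by
    rintro f g ⟨hf, hf', hf''⟩ ⟨hg, hg', hg''⟩
    refine ⟨hf.add hg, fun γ hγ ↦ ?_, fun γ ↦ ?_⟩
    · rw [SlashAction.add_slash, hf' γ hγ, hg' γ hγ]
    · rw [SlashAction.add_slash]; exact (hf'' γ).add (hg'' γ)
  smul_mem' := by
    rintro c f ⟨hf, hf', hf''⟩
    refine ⟨hf.const_smul c, fun γ hγ ↦ ?_, fun γ ↦ ?_⟩
    · rw [SL_smul_slash, hf' γ hγ]
    · rw [SL_smul_slash]
      exact (hf'' γ).smul c

lemma isZeroAtImInfty_mul {f g : ℍ → ℂ} (hf : IsBoundedAtImInfty f) (hg : IsZeroAtImInfty g) :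
    IsZeroAtImInfty (f * g) := by
  have hg' : g =o[atImInfty] (1 : ℍ → ℝ) := (Asymptotics.isLittleO_one_iff ℝ).2 hg
  have := Asymptotics.IsBigO.mul_isLittleO hf hg'
  exact (Asymptotics.isLittleO_one_iff ℝ).1 (this.congr_right fun _ ↦ mul_one _)

lemma isBoundedAtImInfty_of_tendsto {f : ℍ → ℂ} {c : ℂ} (hf : Tendsto f atImInfty (𝓝 c)) :
    IsBoundedAtImInfty f :=
  hf.isBigO_one ℝ

lemma slash_T_zpow_apply (k n : ℤ) (f : ℍ → ℂ) (τ : ℍ) :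
    (f ∣[k] (ModularGroup.T ^ n)) τ = f ((n : ℝ) +ᵥ τ) := by
  rw [SL_slash_apply, modular_T_zpow_smul]
  have : denom ((ModularGroup.T ^ n : SL(2, ℤ)) : GL (Fin 2) ℝ) τ = 1 := by
    rw [ModularGroup.denom_apply, ModularGroup.coe_T_zpow]; simp
  rw [this, one_zpow, mul_one]

section Equiv

variable (Γ : Subgroup SL(2, ℤ)) [Γ.FiniteIndex] (k : ℤ)

lemma isCusp_map_iff {c : OnePoint ℝ} :
    IsCusp c (Γ : Subgroup (GL (Fin 2) ℝ)) ↔ IsCusp c 𝒮ℒ :=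
  Subgroup.IsArithmetic.isCusp_iff_isCusp_SL2Z _

lemma CuspForm.coe_mem_cuspFun (f : CuspForm Γ k) : ⇑f ∈ cuspFun Γ k := by
  refine ⟨f.holo', fun γ hγ ↦ ?_, fun γ ↦ ?_⟩
  · exact f.slash_action_eq' _ ⟨γ, hγ, rfl⟩
  · exact CuspFormClass.zero_at_infty_slash f γ

/-- The modular form attached to an element of `modFun`. -/
def modFunToModularForm (f : modFun Γ k) : ModularForm Γ k where
  toFun := f
  slash_action_eq' := by
    rintro _ ⟨γ, hγ, rfl⟩
    exact f.2.2.1 γ hγ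
  holo' := f.2.1
  bdd_at_cusps' {c} hc := by
    rw [isCusp_map_iff] at hc
    rw [OnePoint.isBoundedAt_iff_forall_SL2Z hc]
    exact fun γ _ ↦ f.2.2.2 γ

/-- The cusp form attached to an element of `cuspFun`. -/
def cuspFunToCuspForm (f : cuspFun Γ k) : CuspForm Γ k where
  toFun := f
  slash_action_eq' := by
    rintro _ ⟨γ, hγ, rfl⟩
    exact f.2.2.1 γ hγ
  holo' := f.2.1
  zero_at_cusps' {c} hc := by
    rw [isCusp_map_iff] at hc
    rw [OnePoint.isZeroAt_iff_forall_SL2Z hc]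
    exact fun γ _ ↦ f.2.2.2 γ

/-- Bundled and unbundled cusp forms agree. -/
def cuspFunEquiv : cuspFun Γ k ≃ₗ[ℂ] CuspForm Γ k where
  toFun := cuspFunToCuspForm Γ k
  invFun f := ⟨f, f.coe_mem_cuspFun Γ k⟩
  map_add' _ _ := rfl
  map_smul' _ _ := rfl
  left_inv _ := rfl
  right_inv _ := rfl

end Equiv

section Basic

variable {Γ : Subgroup SL(2, ℤ)} {k l : ℤ} {f g : ℍ → ℂ}

lemma cuspFun_le_modFun : cuspFun Γ k ≤ modFun Γ k :=
  fun _ hf ↦ ⟨hf.1, hf.2.1, fun γ ↦ (hf.2.2 γ).isBoundedAtImInfty⟩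

lemma modFun_mono {Γ' : Subgroup SL(2, ℤ)} (h : Γ' ≤ Γ) : modFun Γ k ≤ modFun Γ' k :=
  fun _ hf ↦ ⟨hf.1, fun γ hγ ↦ hf.2.1 γ (h hγ), hf.2.2⟩

lemma cuspFun_mono {Γ' : Subgroup SL(2, ℤ)} (h : Γ' ≤ Γ) : cuspFun Γ k ≤ cuspFun Γ' k :=
  fun _ hf ↦ ⟨hf.1, fun γ hγ ↦ hf.2.1 γ (h hγ), hf.2.2⟩

lemma mul_mem_modFun (hf : f ∈ modFun Γ k) (hg : g ∈ modFun Γ l) : f * g ∈ modFun Γ (k + l) := by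
  refine ⟨hf.1.mul hg.1, fun γ hγ ↦ ?_, fun γ ↦ ?_⟩
  · rw [mul_slash_SL2, hf.2.1 γ hγ, hg.2.1 γ hγ]
  · rw [mul_slash_SL2]
    exact (hf.2.2 γ).mul (hg.2.2 γ)

lemma mul_mem_cuspFun (hf : f ∈ modFun Γ k) (hg : g ∈ cuspFun Γ l) :
    f * g ∈ cuspFun Γ (k + l) := by
  refine ⟨hf.1.mul hg.1, fun γ hγ ↦ ?_, fun γ ↦ ?_⟩
  · rw [mul_slash_SL2, hf.2.1 γ hγ, hg.2.1 γ hγ]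
  · rw [mul_slash_SL2]
    exact isZeroAtImInfty_mul (hf.2.2 γ) (hg.2.2 γ)

lemma eq_zero_of_odd (hΓ : -1 ∈ Γ) (hk : Odd k) (hf : f ∈ modFun Γ k) : f = 0 := by
  have h := hf.2.1 _ hΓ
  ext τ
  have h1 := congrFun h τ
  rw [SL_slash_apply] at h1
  have h2 : denom ((-1 : SL(2, ℤ)) : GL (Fin 2) ℝ) τ = -1 := by simp [denom]
  rw [h2, ModularGroup.SL_neg_smul, one_smul, (hk.neg).neg_one_zpow] at h1
  simp only [Pi.zero_apply]
  linear_combination -(1 / 2 : ℂ) * h1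

lemma const_mem_modFun (c : ℂ) : Function.const ℍ c ∈ modFun Γ 0 := by
  have h1 : (1 : ℍ → ℂ) ∈ modFun Γ 0 := ⟨mdifferentiable_const, fun γ _ ↦ is_invariant_one γ,
    fun γ ↦ by rw [is_invariant_one]; exact isBoundedAtImInfty_of_tendsto tendsto_const_nhds⟩
  convert (modFun Γ 0).smul_mem c h1
  ext; simp

variable [Γ.FiniteIndex]

lemma eq_zero_of_neg (hk : k < 0) (hf : f ∈ modFun Γ k) : f = 0 :=
  congrArg DFunLike.coe (ModularForm.isZero_of_neg_weight hk (modFunToModularForm Γ k ⟨f, hf⟩))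

lemma eq_const_of_weight_zero (hf : f ∈ modFun Γ 0) : ∃ c : ℂ, f = Function.const ℍ c :=
  ModularForm.eq_const_of_weight_zero (modFunToModularForm Γ 0 ⟨f, hf⟩)

lemma eq_zero_of_cuspFun_zero (hf : f ∈ cuspFun Γ 0) : f = 0 := by
  obtain ⟨c, rfl⟩ := eq_const_of_weight_zero (cuspFun_le_modFun hf)
  have h := hf.2.2 1
  rw [SlashAction.slash_one] at h
  have := tendsto_nhds_unique h tendsto_const_nhds
  ext; simpa using this.symm

lemma exists_tendsto_slash (hf : f ∈ modFun Γ k) (γ : SL(2, ℤ)) :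
    ∃ c : ℂ, Tendsto (f ∣[k] γ) atImInfty (𝓝 c) := by
  obtain ⟨n, hn, -, hmem⟩ := Subgroup.exists_pow_mem_of_index_ne_zero
    (Subgroup.FiniteIndex.index_ne_zero (H := Γ)) (γ * ModularGroup.T * γ⁻¹)
  have hper : (f ∣[k] γ) ∣[k] (ModularGroup.T ^ n) = f ∣[k] γ := by
    rw [← SlashAction.slash_mul]
    have : γ * ModularGroup.T ^ n = (γ * ModularGroup.T * γ⁻¹) ^ n * γ := by
      rw [conj_pow]; group
    rw [this, SlashAction.slash_mul, hf.2.1 _ hmem]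
  have hm : MDiff (f ∣[k] γ) := hf.1.slash k _
  have hp : Function.Periodic ((f ∣[k] γ) ∘ ofComplex) (n : ℝ) := by
    intro w
    by_cases! hw : 0 < w.im
    · have hw' : 0 < (w + (n : ℝ)).im := by simp [hw]
      simp only [Function.comp_apply, ofComplex_apply_of_im_pos hw', ofComplex_apply_of_im_pos hw]
      have := slash_T_zpow_apply k n (f ∣[k] γ) ⟨w, hw⟩
      rw [zpow_natCast, hper] at this
      rw [this]
      refine congrArg (f ∣[k] γ) ?_
      apply UpperHalfPlane.ext
      simp [add_comm]
    · have hw' : (w + (n : ℝ)).im ≤ 0 := by simpa using hw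
      simp only [Function.comp_apply, ofComplex_apply_of_im_nonpos hw',
        ofComplex_apply_of_im_nonpos hw]
  have hn' : (0 : ℝ) < n := by exact_mod_cast hn
  have h := exp_decay_sub_atImInfty hn' hp hm (hf.2.2 γ)
  refine ⟨valueAtInfty (f ∣[k] γ), ?_⟩
  have h0 : Tendsto (fun τ : ℍ ↦ Real.exp (-2 * Real.pi * τ.im / n)) atImInfty (𝓝 0) := by
    refine Real.tendsto_exp_atBot.comp ?_
    have : Tendsto (fun τ : ℍ ↦ τ.im) atImInfty atTop := tendsto_comap
    have := this.const_mul_atTop_of_neg (r := -2 * Real.pi / n)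
      (div_neg_of_neg_of_pos (by linarith [Real.pi_pos]) hn')
    exact this.congr fun τ ↦ by ring
  exact tendsto_sub_nhds_zero_iff.1 (h.trans_tendsto h0)

end Basic

section LevelOne

variable {k : ℤ} {f : ℍ → ℂ}

lemma ModularForm.coe_mem_modFun_top (f : ModularForm 𝒮ℒ k) : ⇑f ∈ modFun ⊤ k :=
  ⟨f.holo', fun γ _ ↦ f.slash_action_eq' _ ⟨γ, rfl⟩,
    fun γ ↦ ModularFormClass.bdd_at_infty_slash f γ⟩

lemma CuspForm.coe_mem_cuspFun_top (f : CuspForm 𝒮ℒ k) : ⇑f ∈ cuspFun ⊤ k :=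
  ⟨f.holo', fun γ _ ↦ f.slash_action_eq' _ ⟨γ, rfl⟩,
    fun γ ↦ CuspFormClass.zero_at_infty_slash f γ⟩

/-- Bundled and unbundled modular forms of level one agree. -/
def modFunTopEquiv (k : ℤ) : modFun ⊤ k ≃ₗ[ℂ] ModularForm 𝒮ℒ k where
  toFun f :=
    { toFun := f
      slash_action_eq' := by
        rintro _ ⟨γ, rfl⟩
        exact f.2.2.1 γ trivial
      holo' := f.2.1
      bdd_at_cusps' {c} hc := by
        rw [OnePoint.isBoundedAt_iff_forall_SL2Z hc]
        exact fun γ _ ↦ f.2.2.2 γ }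
  invFun f := ⟨f, f.coe_mem_modFun_top⟩
  map_add' _ _ := rfl
  map_smul' _ _ := rfl
  left_inv _ := rfl
  right_inv _ := rfl

/-- Bundled and unbundled cusp forms of level one agree. -/
def cuspFunTopEquiv (k : ℤ) : cuspFun ⊤ k ≃ₗ[ℂ] CuspForm 𝒮ℒ k where
  toFun f :=
    { toFun := f
      slash_action_eq' := by
        rintro _ ⟨γ, rfl⟩
        exact f.2.2.1 γ trivial
      holo' := f.2.1
      zero_at_cusps' {c} hc := by
        rw [OnePoint.isZeroAt_iff_forall_SL2Z hc]
        exact fun γ _ ↦ f.2.2.2 γ }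
  invFun f := ⟨f, f.coe_mem_cuspFun_top⟩
  map_add' _ _ := rfl
  map_smul' _ _ := rfl
  left_inv _ := rfl
  right_inv _ := rfl

local notation "Δ" => ModularForm.discriminant

lemma discriminant_mem_cuspFun : Δ ∈ cuspFun ⊤ 12 := CuspForm.discriminant.coe_mem_cuspFun_top

lemma div_discriminant_mem (hf : f ∈ cuspFun ⊤ k) : (fun z ↦ f z / Δ z) ∈ modFun ⊤ (k - 12) := by
  convert ModularForm.coe_mem_modFun_top
    (CuspForm.discriminantEquiv (cuspFunTopEquiv k ⟨f, hf⟩)) using 1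
  ext z
  rw [CuspForm.discriminantEquiv_apply]
  rfl

lemma finrank_modFun_top (k : ℕ) (hk : Even k) : Module.finrank ℂ (modFun ⊤ k) =
    if k ≡ 2 [MOD 12] then k / 12 else k / 12 + 1 := by
  rw [(modFunTopEquiv k).finrank_eq, Module.finrank, ModularForm.dimension_level_one k hk]
  split_ifs <;> simp

lemma finite_modFun_top (k : ℤ) : FiniteDimensional ℂ (modFun ⊤ k) :=
  Module.Finite.equiv (modFunTopEquiv k).symm

/-- Division by the discriminant. -/
lemma finrank_cuspFun_top (k : ℤ) :
    Module.finrank ℂ (cuspFun ⊤ k) = Module.finrank ℂ (modFun ⊤ (k - 12)) := by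
  rw [(cuspFunTopEquiv k).finrank_eq, (modFunTopEquiv (k - 12)).finrank_eq,
    CuspForm.discriminantEquiv.finrank_eq]

end LevelOne

section Cosets

variable (p : ℕ) [Fact p.Prime]

/-- Representatives of the cosets `Γ₀(p) \ SL(2, ℤ)`. -/
def cosetRep : Option (ZMod p) → SL(2, ℤ)
  | none => 1
  | some j => ModularGroup.S * ModularGroup.T ^ (j.val : ℤ)

/-- The label of the coset of `Γ₀(p) \ SL(2, ℤ)` of a matrix, a point of the projective line. -/
def cosetCls (g : SL(2, ℤ)) : Option (ZMod p) :=
  if (g 1 0 : ZMod p) = 0 then none else some ((g 1 1 : ZMod p) / (g 1 0 : ZMod p))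

variable {p}

lemma cosetRep_some_apply (j : ZMod p) :
    (cosetRep p (some j) : Matrix (Fin 2) (Fin 2) ℤ) = !![0, -1; 1, (j.val : ℤ)] := by
  rw [cosetRep, Matrix.SpecialLinearGroup.coe_mul, ModularGroup.coe_T_zpow]
  simp [ModularGroup.S]

omit [Fact p.Prime] in
lemma cosetRep_none : cosetRep p none = 1 := rfl

lemma cosetCls_cosetRep (i : Option (ZMod p)) : cosetCls p (cosetRep p i) = i := by
  cases i with
  | none => simp [cosetCls, cosetRep]
  | some j => simp [cosetCls, cosetRep_some_apply]

lemma det_cast_eq_one (g : SL(2, ℤ)) :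
    (g 0 0 : ZMod p) * (g 1 1 : ZMod p) - (g 0 1 : ZMod p) * (g 1 0 : ZMod p) = 1 := by
  have := g.det_coe
  rw [Matrix.det_fin_two] at this
  exact_mod_cast congrArg (Int.cast : ℤ → ZMod p) this

lemma cosetCls_eq_iff_cross (g h : SL(2, ℤ)) : cosetCls p g = cosetCls p h ↔
    (g 1 0 : ZMod p) * (h 1 1 : ZMod p) = (g 1 1 : ZMod p) * (h 1 0 : ZMod p) := by
  have hg := det_cast_eq_one (p := p) g
  have hh := det_cast_eq_one (p := p) h
  unfold cosetCls
  split_ifs with h1 h2 h2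
  · simp [h1, h2]
  · have : (g 1 1 : ZMod p) ≠ 0 := by rintro h; simp [h1, h] at hg
    simp [h1, h2, this]
  · have : (h 1 1 : ZMod p) ≠ 0 := by rintro h; simp [h2, h] at hh
    simp [h1, h2, this]
  · rw [Option.some_inj, div_eq_div_iff h1 h2]
    constructor <;> intro h <;> linear_combination -h

lemma cosetCls_eq_iff (g h : SL(2, ℤ)) :
    cosetCls p g = cosetCls p h ↔ g * h⁻¹ ∈ Gamma0 p := by
  rw [cosetCls_eq_iff_cross, Gamma0_mem]
  rw [Matrix.SpecialLinearGroup.coe_mul, Matrix.SpecialLinearGroup.coe_inv, Matrix.adjugate_fin_two]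
  simp [Matrix.mul_apply, Fin.sum_univ_two]
  constructor <;> intro h <;> linear_combination h

lemma cosetCls_mul_congr {g h : SL(2, ℤ)} (H : cosetCls p g = cosetCls p h) (x : SL(2, ℤ)) :
    cosetCls p (g * x) = cosetCls p (h * x) := by
  rw [cosetCls_eq_iff] at *
  simpa [mul_assoc] using H

lemma cosetCls_cosetRep_mul (g x : SL(2, ℤ)) :
    cosetCls p (cosetRep p (cosetCls p g) * x) = cosetCls p (g * x) :=
  cosetCls_mul_congr (cosetCls_cosetRep _) _

variable (p) in
/-- The right action of `SL(2, ℤ)` on the cosets `Γ₀(p) \ SL(2, ℤ)`. -/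
def cosetPerm (g : SL(2, ℤ)) : Equiv.Perm (Option (ZMod p)) where
  toFun i := cosetCls p (cosetRep p i * g)
  invFun i := cosetCls p (cosetRep p i * g⁻¹)
  left_inv i := by dsimp only; rw [cosetCls_cosetRep_mul, mul_inv_cancel_right, cosetCls_cosetRep]
  right_inv i := by dsimp only; rw [cosetCls_cosetRep_mul, inv_mul_cancel_right, cosetCls_cosetRep]

variable {k : ℤ} {f : ℍ → ℂ}

lemma slash_eq_of_cosetCls_eq (hf : ∀ γ ∈ Gamma0 p, f ∣[k] γ = f) {g h : SL(2, ℤ)}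
    (H : cosetCls p g = cosetCls p h) : f ∣[k] g = f ∣[k] h := by
  rw [cosetCls_eq_iff] at H
  rw [← inv_mul_cancel_right g h, SlashAction.slash_mul, hf _ H]

lemma slash_eq_cosetRep (hf : ∀ γ ∈ Gamma0 p, f ∣[k] γ = f) (g : SL(2, ℤ)) :
    f ∣[k] g = f ∣[k] cosetRep p (cosetCls p g) :=
  slash_eq_of_cosetCls_eq hf (cosetCls_cosetRep _).symm

lemma slash_cosetRep_slash (hf : ∀ γ ∈ Gamma0 p, f ∣[k] γ = f) (i : Option (ZMod p))
    (g : SL(2, ℤ)) : (f ∣[k] cosetRep p i) ∣[k] g = f ∣[k] cosetRep p (cosetPerm p g i) := by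
  rw [← SlashAction.slash_mul, slash_eq_cosetRep hf]
  rfl

lemma sum_slash_cosetRep_slash (hf : ∀ γ ∈ Gamma0 p, f ∣[k] γ = f) (g : SL(2, ℤ)) :
    (∑ i, f ∣[k] cosetRep p i) ∣[k] g = ∑ i, f ∣[k] cosetRep p i := by
  rw [SlashAction.sum_slash]
  simp_rw [slash_cosetRep_slash hf]
  exact Equiv.sum_comp (cosetPerm p g) (fun i ↦ f ∣[k] cosetRep p i)

lemma trace_mem_cuspFun (hf : f ∈ cuspFun (Gamma0 p) k) :
    ∑ i, f ∣[k] cosetRep p i ∈ cuspFun ⊤ k := by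
  refine ⟨.sum fun i _ ↦ hf.1.slash k _, fun γ _ ↦ sum_slash_cosetRep_slash hf.2.1 γ, fun γ ↦ ?_⟩
  rw [sum_slash_cosetRep_slash hf.2.1 γ]
  exact sum_mem (S := zeroAtFilterSubmodule ℂ atImInfty) fun i _ ↦ hf.2.2 _

end Cosets

lemma hasSum_eval_mul_pow {ι : Type*} {c z : ι → ℂ} {m : ℕ}
    (h : ∀ n ≥ m, HasSum (fun x ↦ c x * z x ^ n) 0) (Q : Polynomial ℂ) :
    ∀ n ≥ m, HasSum (fun x ↦ c x * Q.eval (z x) * z x ^ n) 0 := by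
  intro n hn
  induction Q using Polynomial.induction_on' with
  | add P Q hP hQ =>
    have h1 := hP.add hQ
    rw [add_zero] at h1
    refine (congrArg (HasSum · 0) (funext fun x ↦ ?_)).mp h1
    rw [Polynomial.eval_add]; ring
  | monomial d a =>
    have h1 := (h (n + d) (by omega)).mul_left a
    rw [mul_zero] at h1
    refine (congrArg (HasSum · 0) (funext fun x ↦ ?_)).mp h1
    rw [Polynomial.eval_monomial]; ring

/-- If all high enough power moments of a countable measure vanish, so does its mass at each
nonzero point outside of which only finitely many points are at least as large. -/
lemma sum_filter_eq_zero_of_hasSum_pow {ι : Type*} {c z : ι → ℂ} {m : ℕ}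
    (h : ∀ n ≥ m, HasSum (fun x ↦ c x * z x ^ n) 0) (x₀ : ι) (hx₀ : z x₀ ≠ 0)
    (hfin : {x | ‖z x₀‖ ≤ ‖z x‖}.Finite) (s : Finset ι) (hs : ∀ x, x ∈ s ↔ z x = z x₀) :
    ∑ x ∈ s, c x = 0 := by
  classical
  set F := hfin.toFinset.filter (fun x ↦ z x ≠ z x₀) with hF
  set Q : Polynomial ℂ := ∏ x ∈ F, (Polynomial.X - Polynomial.C (z x)) with hQ
  have hQ0 : Q.eval (z x₀) ≠ 0 := by
    rw [hQ, Polynomial.eval_prod, Finset.prod_ne_zero_iff]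
    intro x hx
    simp only [Polynomial.eval_sub, Polynomial.eval_X, Polynomial.eval_C, sub_ne_zero]
    exact (Finset.mem_filter.1 hx).2.symm
  have hQF : ∀ x, ‖z x₀‖ ≤ ‖z x‖ → z x ≠ z x₀ → Q.eval (z x) = 0 := by
    intro x hx hx'
    rw [hQ, Polynomial.eval_prod]
    exact Finset.prod_eq_zero (i := x) (by simp [hF, hx, hx']) (by simp)
  have hsum := hasSum_eval_mul_pow h Q
  set g : ι → ℂ := fun x ↦ if z x = z x₀ then c x * Q.eval (z x₀) else 0 with hg
  have hterm : ∀ n ≥ m, HasSum (fun x ↦ c x * Q.eval (z x) * (z x / z x₀) ^ n) 0 := by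
    intro n hn
    have h1 := (hsum n hn).mul_right ((z x₀ ^ n)⁻¹)
    rw [zero_mul] at h1
    refine (congrArg (HasSum · 0) (funext fun x ↦ ?_)).mp h1
    rw [div_pow]; ring
  have hlim : Tendsto (fun n : ℕ ↦ ∑' x, c x * Q.eval (z x) * (z x / z x₀) ^ n) atTop
      (𝓝 (∑' x, g x)) := by
    refine tendsto_tsum_of_dominated_convergence (hterm m le_rfl).summable.norm ?_ ?_
    · intro x
      simp only [hg]
      split_ifs with hx
      · rw [hx, div_self hx₀]; simp
      · rcases le_or_gt ‖z x₀‖ ‖z x‖ with hx' | hx'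
        · simp [hQF x hx' hx]
        · have : ‖z x / z x₀‖ < 1 := by
            rw [norm_div, div_lt_one (norm_pos_iff.2 hx₀)]; exact hx'
          simpa using (tendsto_pow_atTop_nhds_zero_of_norm_lt_one this).const_mul
            (c x * Q.eval (z x))
    · filter_upwards [eventually_ge_atTop m] with n hn x
      by_cases hx : z x = z x₀
      · simp [hx, div_self hx₀]
      rcases le_or_gt ‖z x₀‖ ‖z x‖ with hx' | hx'
      · simp [hQF x hx' hx]
      · rw [norm_mul, norm_mul _ ((z x / z x₀) ^ m)]
        refine mul_le_mul_of_nonneg_left ?_ (norm_nonneg _)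
        rw [norm_pow, norm_pow]
        refine pow_le_pow_of_le_one (norm_nonneg _) ?_ hn
        rw [norm_div, div_le_one (norm_pos_iff.2 hx₀)]; exact hx'.le
  have hzero : ∑' x, g x = 0 := by
    refine tendsto_nhds_unique hlim (tendsto_const_nhds.congr' ?_)
    filter_upwards [eventually_ge_atTop m] with n hn
    exact (hterm n hn).tsum_eq.symm
  rw [tsum_eq_sum (s := s) (fun x hx ↦ by simp [hg, (hs x).not.1 hx])] at hzero
  rw [Finset.sum_congr rfl (fun x hx ↦ by simp only [hg]; rw [if_pos ((hs x).1 hx)]),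
    ← Finset.sum_mul] at hzero
  exact (mul_eq_zero.1 hzero).resolve_right hQ0

lemma int_linear_injective (τ : ℍ) {x y : Fin 2 → ℤ}
    (h : (x 0 : ℂ) * τ + x 1 = y 0 * τ + y 1) : x = y := by
  have him := congrArg Complex.im h
  have hre := congrArg Complex.re h
  simp only [Complex.add_im, Complex.mul_im, Complex.intCast_re, Complex.intCast_im, zero_mul,
    add_zero, coe_im, Complex.add_re, Complex.mul_re, sub_zero] at him hre
  have h0 : x 0 = y 0 := by exact_mod_cast mul_right_cancel₀ τ.im_pos.ne' him
  rw [h0] at hre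
  have h1 : x 1 = y 1 := by exact_mod_cast add_left_cancel hre
  ext i; fin_cases i <;> assumption

lemma finite_norm_int_linear_le (τ : ℍ) (C : ℝ) :
    {x : Fin 2 → ℤ | ‖(x 0 : ℂ) * τ + x 1‖ ≤ C}.Finite := by
  refine (Metric.finite_isBounded_inter_isClosed (s := Set.univ)
    DiscreteTopology.isDiscrete (Metric.isBounded_closedBall (x := (0 : Fin 2 → ℤ))
      (r := max 0 (C / EisensteinSeries.r τ))) isClosed_univ).subset ?_
  intro x hx
  simp only [Set.inter_univ, mem_closedBall_zero_iff]
  by_cases hx0 : x = 0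
  · simp [hx0]
  · refine le_max_of_le_right ?_
    rw [le_div_iff₀' (EisensteinSeries.r_pos τ)]
    exact (EisensteinSeries.r_mul_max_le τ hx0).trans hx

lemma eq_zero_of_hasSum_eisSummand (τ : ℍ) (c : (Fin 2 → ℤ) → ℂ) (hc : ∀ x, c (-x) = c x)
    (h : ∀ n : ℕ, 2 ≤ n → HasSum (fun x ↦ c x * EisensteinSeries.eisSummand (2 * n : ℤ) x τ) 0)
    (x : Fin 2 → ℤ) (hx : x ≠ 0) : c x = 0 := by
  set z : (Fin 2 → ℤ) → ℂ := fun x ↦ (((x 0 : ℂ) * τ + x 1) ^ 2)⁻¹ with hz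
  have hw : ∀ y : Fin 2 → ℤ, y ≠ 0 → (y 0 : ℂ) * τ + y 1 ≠ 0 := by
    intro y hy h
    exact hy (int_linear_injective τ (y := 0) (by simpa using h))
  have hzx : z x ≠ 0 := inv_ne_zero (pow_ne_zero _ (hw x hx))
  have hne : x ≠ -x := by
    intro h
    apply hx
    ext i
    have := congrFun h i
    simp only [Pi.neg_apply] at this
    simp only [Pi.zero_apply]
    omega
  have key := sum_filter_eq_zero_of_hasSum_pow (c := c) (z := z) (m := 2) ?_ x hzx ?_ {x, -x} ?_
  · rw [Finset.sum_pair hne, hc] at key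
    simpa using key
  · intro n hn
    convert h n hn using 2 with y
    rw [EisensteinSeries.eisSummand, hz, inv_pow, ← pow_mul, zpow_neg]
    norm_cast
  · refine (finite_norm_int_linear_le τ ‖(x 0 : ℂ) * τ + x 1‖).subset ?_
    intro y hy
    simp only [Set.mem_ofPred_eq, hz, norm_inv, norm_pow] at hy ⊢
    by_cases hy0 : y = 0
    · simp [hy0]
    rw [inv_le_inv₀ (pow_pos (norm_pos_iff.2 (hw x hx)) _)
      (pow_pos (norm_pos_iff.2 (hw y hy0)) _)] at hy
    exact le_of_sq_le_sq hy (norm_nonneg _)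
  · intro y
    simp only [Finset.mem_insert, Finset.mem_singleton, hz, inv_inj, sq_eq_sq_iff_eq_or_eq_neg]
    constructor
    · rintro (rfl | rfl)
      · left; rfl
      · right; simp; ring
    · rintro (h | h)
      · left; exact int_linear_injective τ h
      · right; refine int_linear_injective τ ?_
        rw [h]; simp; ring

section Eisenstein

open EisensteinSeries

variable {p : ℕ} [Fact p.Prime]

variable (p) in
/-- The Eisenstein series attached to the cusp `∞` of `Γ₀(p)`. -/
noncomputable def eisensteinGamma0 (k : ℤ) : ℍ → ℂ :=
  ∑ u : (ZMod p)ˣ, eisensteinSeries ![0, (u : ZMod p)] k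

lemma eisensteinGamma0_slash (k : ℤ) (γ : SL(2, ℤ)) : eisensteinGamma0 p k ∣[k] γ =
    ∑ u : (ZMod p)ˣ,
      eisensteinSeries ![(u : ZMod p) * (γ 1 0 : ZMod p), u * (γ 1 1 : ZMod p)] k := by
  rw [eisensteinGamma0, SlashAction.sum_slash]
  refine Finset.sum_congr rfl fun u _ ↦ ?_
  rw [eisensteinSeries_slash_apply]
  congr 1
  ext i
  fin_cases i <;> simp [Matrix.vecMul, dotProduct]

lemma eisensteinGamma0_mem {k : ℤ} (hk : 3 ≤ k) : eisensteinGamma0 p k ∈ modFun (Gamma0 p) k := by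
  refine ⟨.sum fun u _ ↦ eisensteinSeriesSIF_mdifferentiable hk _, fun γ hγ ↦ ?_, fun γ ↦ ?_⟩
  · rw [Gamma0_mem] at hγ
    have hd := det_cast_eq_one (p := p) γ
    rw [hγ, mul_zero, sub_zero, mul_comm] at hd
    have hu : IsUnit (γ 1 1 : ZMod p) := .of_mul_eq_one _ hd
    rw [eisensteinGamma0_slash]
    simp only [hγ, mul_zero]
    refine Fintype.sum_equiv (Equiv.mulRight hu.unit) _ _ fun u ↦ ?_
    simp
  · rw [eisensteinGamma0, SlashAction.sum_slash]
    exact sum_mem (S := boundedFilterSubalgebra ℂ atImInfty) fun u _ ↦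
      isBoundedAtImInfty_eisensteinSeriesSIF _ hk γ

/-- The row vector modulo `p` indexed by a coset and a unit. -/
def cosetRow (i : Option (ZMod p)) (u : (ZMod p)ˣ) : Fin 2 → ZMod p :=
  ![(u : ZMod p) * (cosetRep p i 1 0 : ZMod p), u * (cosetRep p i 1 1 : ZMod p)]

lemma cosetRow_inj {i j : Option (ZMod p)} {u v : (ZMod p)ˣ} :
    cosetRow i u = cosetRow j v ↔ i = j ∧ u = v := by
  constructor
  · intro h
    have h0 := congrFun h 0
    have h1 := congrFun h 1
    rcases i with _ | i <;> rcases j with _ | j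
    · simp_all [cosetRow, cosetRep_none, Units.ext_iff]
    · exact absurd h0.symm (by simp [cosetRow, cosetRep_some_apply, cosetRep_none])
    · simp_all [cosetRow, cosetRep_some_apply, cosetRep_none]
    · simp_all [cosetRow, cosetRep_some_apply, Units.ext_iff]
  · rintro ⟨rfl, rfl⟩; rfl

omit [Fact p.Prime] in
lemma hasSum_eisensteinSeries {k : ℤ} (hk : 3 ≤ k) (a : Fin 2 → ZMod p) (τ : ℍ) :
    HasSum ((gammaSet p 1 a).indicator fun x ↦ eisSummand k x τ) (eisensteinSeries a k τ) := by
  rw [eisensteinSeries, tsum_subtype (gammaSet p 1 a) fun x ↦ eisSummand k x τ]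
  exact ((summable_norm_eisSummand hk τ).of_norm.indicator _).hasSum

open Classical in
/-- The values at a point of the modular forms for `Γ₀(p)` at all cosets satisfy no linear
relation. -/
theorem eq_zero_of_forall_sum_eq_zero (τ : ℍ) (v : Option (ZMod p) → ℂ)
    (hv : ∀ k : ℤ, ∀ f ∈ modFun (Gamma0 p) k, ∑ i, v i * (f ∣[k] cosetRep p i) τ = 0) : v = 0 := by
  set c : (Fin 2 → ℤ) → ℂ := fun x ↦
    ∑ i, ∑ u : (ZMod p)ˣ, if x ∈ gammaSet p 1 (cosetRow i u) then v i else 0 with hc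
  have hneg : ∀ x, c (-x) = c x := by
    intro x
    refine Finset.sum_congr rfl fun i _ ↦ ?_
    refine Fintype.sum_equiv (Equiv.neg _) _ _ fun u ↦ ?_
    refine if_congr ?_ rfl rfl
    simp only [gammaSet, Set.mem_ofPred_eq, Equiv.neg_apply]
    refine and_congr ?_ (by simp)
    simp only [funext_iff, Fin.forall_fin_two]
    simp [cosetRow, neg_eq_iff_eq_neg]
  have hsum : ∀ n : ℕ, 2 ≤ n → HasSum (fun x ↦ c x * eisSummand (2 * n : ℤ) x τ) 0 := by
    intro n hn
    have hk : (3 : ℤ) ≤ 2 * n := by omega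
    have h0 := hv _ _ (eisensteinGamma0_mem (p := p) hk)
    simp_rw [eisensteinGamma0_slash, Finset.sum_apply, Finset.mul_sum] at h0
    rw [← h0]
    have := hasSum_sum (s := Finset.univ) fun i (_ : i ∈ Finset.univ) ↦
      hasSum_sum (s := Finset.univ) fun (u : (ZMod p)ˣ) (_ : u ∈ Finset.univ) ↦
        (hasSum_eisensteinSeries hk (cosetRow i u) τ).mul_left (v i)
    refine (congrArg (HasSum · _) (funext fun x ↦ ?_)).mp this
    simp only [hc, Finset.sum_mul, Set.indicator_apply, ite_mul, mul_ite, zero_mul, mul_zero]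
  have hzero := eq_zero_of_hasSum_eisSummand τ c hneg hsum
  ext i
  set x : Fin 2 → ℤ := fun j ↦ cosetRep p i 1 j with hx
  have hgcd : (x 0).gcd (x 1) = 1 := by
    rw [← Int.isCoprime_iff_gcd_eq_one]
    exact (cosetRep p i).isCoprime_row 1
  have hx0 : x ≠ 0 := by
    intro h
    simp [h] at hgcd
  have hmem : ∀ j u, x ∈ gammaSet p 1 (cosetRow j u) ↔ i = j ∧ 1 = u := by
    intro j u
    rw [← cosetRow_inj]
    simp only [gammaSet, Set.mem_ofPred_eq, hgcd, and_true]
    refine Eq.congr ?_ rfl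
    ext l; fin_cases l <;> simp [cosetRow, hx]
  have := hzero x hx0
  simp only [hc, hmem, ite_and] at this
  simpa using this

end Eisenstein

section LevelOneStructure

local notation "Δ" => ModularForm.discriminant

variable {k l : ℤ} {f g : ℍ → ℂ}

lemma E_four_mem : (⇑E₄ : ℍ → ℂ) ∈ modFun ⊤ 4 := E₄.coe_mem_modFun_top

lemma E_six_mem : (⇑E₆ : ℍ → ℂ) ∈ modFun ⊤ 6 := E₆.coe_mem_modFun_top

lemma tendsto_of_qExpansion_coeff_zero (f : ModularForm 𝒮ℒ k) :
    Tendsto f atImInfty (𝓝 ((qExpansion 1 f).coeff 0)) := by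
  obtain ⟨c, hc⟩ := exists_tendsto_slash f.coe_mem_modFun_top 1
  rw [SlashAction.slash_one] at hc
  rwa [UpperHalfPlane.qExpansion_coeff_zero one_pos
    (ModularFormClass.analyticAt_cuspFunction_zero f one_pos one_mem_strictPeriods_SL)
    (SlashInvariantFormClass.periodic_comp_ofComplex f one_mem_strictPeriods_SL),
    valueAtInfty, hc.limUnder_eq]

lemma tendsto_E_four : Tendsto (⇑E₄ : ℍ → ℂ) atImInfty (𝓝 1) := by
  have := tendsto_of_qExpansion_coeff_zero E₄
  rwa [EisensteinSeries.E_qExpansion_coeff_zero _ ⟨2, rfl⟩] at this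

lemma tendsto_E_six : Tendsto (⇑E₆ : ℍ → ℂ) atImInfty (𝓝 1) := by
  have := tendsto_of_qExpansion_coeff_zero E₆
  rwa [EisensteinSeries.E_qExpansion_coeff_zero _ ⟨3, rfl⟩] at this

lemma mem_cuspFun_top_of_tendsto (hf : f ∈ modFun ⊤ k) (h : Tendsto f atImInfty (𝓝 0)) :
    f ∈ cuspFun ⊤ k :=
  ⟨hf.1, hf.2.1, fun γ ↦ by rw [hf.2.1 γ trivial]; exact h⟩

lemma modFun_congr {Γ : Subgroup SL(2, ℤ)} (h : k = l) (hf : f ∈ modFun Γ k) : f ∈ modFun Γ l :=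
  h ▸ hf

lemma pow_mem_modFun {Γ : Subgroup SL(2, ℤ)} (hf : f ∈ modFun Γ k) (n : ℕ) :
    f ^ n ∈ modFun Γ (n * k) := by
  induction n with
  | zero =>
    refine modFun_congr (by simp) (const_mem_modFun 1)
  | succ n ih =>
    rw [pow_succ]
    exact modFun_congr (by push_cast; ring) (mul_mem_modFun ih hf)

lemma eq_zero_of_weight_two (hf : f ∈ modFun ⊤ 2) : f = 0 := by
  have h := finrank_modFun_top 2 even_two
  rw [if_pos (by decide)] at h
  have := finite_modFun_top 2
  have h2 := (Submodule.finrank_eq_zero (S := modFun ⊤ (2 : ℤ))).1 (by simpa using h)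
  simpa [h2] using hf

/-- Modular forms of level one and nonzero weight lie in the ideal generated by `E₄`, `E₆`. -/
lemma exists_eq_E_four_mul_add_E_six_mul (hk : k ≠ 0) (hf : f ∈ modFun ⊤ k) :
    ∃ s ∈ modFun ⊤ (k - 4), ∃ t ∈ modFun ⊤ (k - 6), f = E₄ * s + E₆ * t := by
  have htriv (h : f = 0) : ∃ s ∈ modFun ⊤ (k - 4), ∃ t ∈ modFun ⊤ (k - 6), f = E₄ * s + E₆ * t :=
    ⟨0, zero_mem _, 0, zero_mem _, by simp [h]⟩
  rcases lt_or_ge k 0 with hneg | hpos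
  · exact htriv (eq_zero_of_neg hneg hf)
  rcases Int.even_or_odd k with heven | hodd
  swap
  · exact htriv (eq_zero_of_odd (Subgroup.mem_top _) hodd hf)
  by_cases h2 : k = 2
  · subst h2
    exact htriv (eq_zero_of_weight_two hf)
  obtain ⟨c, hc⟩ := exists_tendsto_slash hf 1
  rw [SlashAction.slash_one] at hc
  have hsplit : ∃ e ∈ modFun ⊤ k, Tendsto e atImInfty (𝓝 1) ∧
      ∃ s ∈ modFun ⊤ (k - 4), ∃ t ∈ modFun ⊤ (k - 6), e = E₄ * s + E₆ * t := by
    obtain ⟨n, rfl⟩ := heven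
    rcases Int.even_or_odd n with ⟨m, rfl⟩ | ⟨m, rfl⟩
    · obtain ⟨a, rfl⟩ : ∃ a : ℕ, m = a + 1 := ⟨(m - 1).toNat, by omega⟩
      have ha := modFun_congr (l := (a + 1 + (a + 1) + (a + 1 + (a + 1)) : ℤ) - 4) (by ring)
        (pow_mem_modFun E_four_mem a)
      refine ⟨E₄ * E₄ ^ a, ?_, ?_, E₄ ^ a, ha, 0, zero_mem _, by simp⟩
      · exact modFun_congr (by ring) (mul_mem_modFun E_four_mem ha)
      · simpa [Pi.mul_def, Pi.pow_def] using tendsto_E_four.mul (tendsto_E_four.pow a)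
    · obtain ⟨a, rfl⟩ : ∃ a : ℕ, m = a + 1 := ⟨(m - 1).toNat, by omega⟩
      have ha := modFun_congr (l := (2 * (a + 1 : ℤ) + 1 + (2 * (a + 1) + 1)) - 6) (by ring)
        (pow_mem_modFun E_four_mem a)
      refine ⟨E₆ * E₄ ^ a, ?_, ?_, 0, zero_mem _, E₄ ^ a, ha, by simp⟩
      · exact modFun_congr (by ring) (mul_mem_modFun E_six_mem ha)
      · simpa [Pi.mul_def, Pi.pow_def] using tendsto_E_six.mul (tendsto_E_four.pow a)
  obtain ⟨e, he, he1, s, hs, t, ht, rfl⟩ := hsplit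
  set e := (E₄ * s + E₆ * t : ℍ → ℂ)
  have hcusp : f - c • e ∈ cuspFun ⊤ k := by
    refine mem_cuspFun_top_of_tendsto (sub_mem hf (Submodule.smul_mem _ _ he)) ?_
    simpa [Pi.sub_def, Pi.smul_def] using hc.sub (he1.const_smul c)
  have hg := div_discriminant_mem hcusp
  set g : ℍ → ℂ := fun z ↦ (f - c • e) z / Δ z with hgdef
  refine ⟨c • s + (1 / 1728 : ℂ) • (E₄ ^ 2 * g), ?_, c • t - (1 / 1728 : ℂ) • (E₆ * g), ?_, ?_⟩
  · refine add_mem (Submodule.smul_mem _ _ hs) (Submodule.smul_mem _ _ ?_)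
    exact modFun_congr (by push_cast; ring) (mul_mem_modFun (pow_mem_modFun E_four_mem 2) hg)
  · refine sub_mem (Submodule.smul_mem _ _ ht) (Submodule.smul_mem _ _ ?_)
    exact modFun_congr (by ring) (mul_mem_modFun E_six_mem hg)
  · ext z
    have h1 : g z * Δ z = f z - c * e z := by
      simp [hgdef, div_mul_cancel₀ _ (discriminant_ne_zero z)]
    rw [discriminant_eq_E₄_cube_sub_E₆_sq] at h1
    have h2 : e z = E₄ z * s z + E₆ z * t z := rfl
    simp only [Pi.add_apply, Pi.mul_apply, Pi.smul_apply, smul_eq_mul, Pi.sub_apply, Pi.pow_apply]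
    linear_combination -h1 + c * h2

/-- `E₄`, `E₆` form a regular sequence on modular forms of any level. -/
lemma exists_eq_mul_of_E_four_mul_eq {Γ : Subgroup SL(2, ℤ)} (hf : f ∈ modFun Γ k)
    (hg : g ∈ modFun Γ l) (hkl : k + 4 = l + 6) (h : E₄ * f = E₆ * g) :
    ∃ u ∈ modFun Γ (k - 6), f = E₆ * u ∧ g = E₄ * u := by
  set u : ℍ → ℂ := (E₄ ^ 2 * g - E₆ * f) / ((1728 : ℂ) • Δ) with hu
  have hz : ∀ z, E₄ z * f z = E₆ z * g z := fun z ↦ congrFun h z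
  have hfu : f = E₆ * u := by
    ext z
    have := discriminant_ne_zero z
    simp only [hu, Pi.mul_apply, Pi.div_apply, Pi.sub_apply, Pi.pow_apply, Pi.smul_apply,
      smul_eq_mul]
    rw [mul_div_assoc', eq_div_iff (by simp [this]), discriminant_eq_E₄_cube_sub_E₆_sq]
    linear_combination (E₄ z ^ 2) * hz z
  have hgu : g = E₄ * u := by
    ext z
    have := discriminant_ne_zero z
    simp only [hu, Pi.mul_apply, Pi.div_apply, Pi.sub_apply, Pi.pow_apply, Pi.smul_apply,
      smul_eq_mul]
    rw [mul_div_assoc', eq_div_iff (by simp [this]), discriminant_eq_E₄_cube_sub_E₆_sq]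
    linear_combination (E₆ z) * hz z
  have h4 := modFun_mono (le_top : Γ ≤ ⊤) E_four_mem
  have h6 := modFun_mono (le_top : Γ ≤ ⊤) E_six_mem
  have hΔ : (1728 : ℂ) • Δ ∈ cuspFun Γ 12 :=
    Submodule.smul_mem _ _ (cuspFun_mono le_top discriminant_mem_cuspFun)
  have hnum : (E₄ ^ 2 * g - E₆ * f : ℍ → ℂ) ∈ modFun Γ (k - 6 + 12) :=
    sub_mem (modFun_congr (by push_cast; linarith) (mul_mem_modFun (pow_mem_modFun h4 2) hg))
      (modFun_congr (by ring) (mul_mem_modFun h6 hf))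
  refine ⟨u, ⟨?_, fun γ hγ ↦ ?_, fun γ ↦ ?_⟩, hfu, hgu⟩
  · exact hnum.1.div hΔ.1 fun z ↦ by simp [discriminant_ne_zero z]
  · rw [hu, ← add_sub_cancel_right (k - 6) 12, div_slash_SL2, hnum.2.1 γ hγ, hΔ.2.1 γ hγ]
  · have h1 : f ∣[k] γ = E₆ * (u ∣[k - 6] γ) := by
      conv_lhs => rw [hfu, ← add_sub_cancel 6 k, mul_slash_SL2, E_six_mem.2.1 γ trivial]
    have h2 : (fun z ↦ (E₆ z)⁻¹) =O[atImInfty] (1 : ℍ → ℝ) :=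
      isBoundedAtImInfty_of_tendsto (tendsto_E_six.inv₀ one_ne_zero)
    have h3 : (fun z ↦ (E₆ z)⁻¹ * (f ∣[k] γ) z) =O[atImInfty] (1 : ℍ → ℝ) := by
      exact (h2.mul (hf.2.2 γ)).congr_right fun _ ↦ mul_one _
    refine h3.congr' ?_ .rfl
    filter_upwards [tendsto_E_six.eventually_ne one_ne_zero] with z hz
    rw [h1, Pi.mul_apply, inv_mul_cancel_left₀ hz]

end LevelOneStructure

section Free

lemma exists_complement_family {ι A : Type} [AddCommGroup A] [Module ℂ A]
    (N M : ι → Submodule ℂ A) (hNM : ∀ k, N k ≤ M k) : ∃ (J : Type) (w : J → ι) (b : J → A),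
    (∀ j, b j ≠ 0) ∧ (∀ j, b j ∈ M (w j)) ∧
    (∀ k, LinearIndepOn ℂ b {j | w j = k}) ∧
    (∀ k, M k ≤ N k ⊔ Submodule.span ℂ (b '' {j | w j = k})) ∧
    (∀ k, Disjoint (N k) (Submodule.span ℂ (b '' {j | w j = k}))) := by
  choose C hC using fun k ↦ Submodule.exists_isCompl (N k)
  have hex : ∀ k, ∃ s : Set A, Submodule.span ℂ s = C k ⊓ M k ∧ LinearIndepOn ℂ id s := by
    intro k
    obtain ⟨s, -, h1, h2⟩ := exists_linearIndependent ℂ ((C k ⊓ M k : Submodule ℂ A) : Set A)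
    exact ⟨s, by rw [h1, Submodule.span_eq], h2⟩
  choose s hs hli using hex
  have himg : ∀ k, (fun j : Σ k, s k ↦ (j.2 : A)) '' {j | j.1 = k} = s k := by
    intro k
    ext x
    constructor
    · rintro ⟨⟨k', y⟩, rfl, rfl⟩
      exact y.2
    · exact fun hx ↦ ⟨⟨k, x, hx⟩, rfl, rfl⟩
  refine ⟨Σ k, s k, Sigma.fst, fun j ↦ j.2, ?_, ?_, ?_, ?_, ?_⟩
  · exact fun j ↦ (hli j.1).ne_zero j.2.2
  · intro j
    have : (j.2 : A) ∈ C j.1 ⊓ M j.1 := hs j.1 ▸ Submodule.subset_span j.2.2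
    exact this.2
  · intro k
    refine (linearIndepOn_iff_image ?_).2 ?_
    · rintro ⟨_, x⟩ rfl ⟨_, y⟩ rfl h
      exact congrArg _ (Subtype.ext h)
    · rw [himg]; exact hli k
  · intro k x hx
    rw [himg, hs]
    have := Submodule.mem_top (x := x) (R := ℂ)
    rw [← (hC k).sup_eq_top, Submodule.mem_sup] at this
    obtain ⟨y, hy, z, hz, rfl⟩ := this
    exact Submodule.add_mem_sup hy ⟨hz, by simpa using sub_mem hx (hNM k hy)⟩
  · intro k
    rw [himg, hs]
    exact (hC k).disjoint.mono_right inf_le_left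

variable (Γ : Subgroup SL(2, ℤ))

/-- The part of `modFun Γ k` generated from lower weights by `E₄` and `E₆`. -/
noncomputable def decomposableFun (k : ℤ) : Submodule ℂ (ℍ → ℂ) :=
  (modFun Γ (k - 4)).map (LinearMap.mulLeft ℂ (⇑E₄ : ℍ → ℂ)) ⊔
    (modFun Γ (k - 6)).map (LinearMap.mulLeft ℂ (⇑E₆ : ℍ → ℂ))

variable {Γ}

lemma mem_decomposableFun {k : ℤ} {f : ℍ → ℂ} : f ∈ decomposableFun Γ k ↔
    ∃ s ∈ modFun Γ (k - 4), ∃ t ∈ modFun Γ (k - 6), E₄ * s + E₆ * t = f := by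
  simp [decomposableFun, Submodule.mem_sup]

lemma decomposableFun_le (k : ℤ) : decomposableFun Γ k ≤ modFun Γ k := by
  intro f hf
  obtain ⟨s, hs, t, ht, rfl⟩ := mem_decomposableFun.1 hf
  exact add_mem (modFun_congr (by ring) (mul_mem_modFun (modFun_mono le_top E_four_mem) hs))
    (modFun_congr (by ring) (mul_mem_modFun (modFun_mono le_top E_six_mem) ht))

variable (Γ) in
lemma exists_indecomposable_family : ∃ (J : Type) (w : J → ℤ) (b : J → ℍ → ℂ),
    (∀ j, b j ≠ 0) ∧ (∀ j, b j ∈ modFun Γ (w j)) ∧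
    (∀ k, LinearIndepOn ℂ b {j | w j = k}) ∧
    (∀ k, modFun Γ k ≤ decomposableFun Γ k ⊔ Submodule.span ℂ (b '' {j | w j = k})) ∧
    (∀ k, Disjoint (decomposableFun Γ k) (Submodule.span ℂ (b '' {j | w j = k}))) :=
  exists_complement_family _ _ decomposableFun_le

variable [Γ.FiniteIndex] {J : Type} {w : J → ℤ} {b : J → ℍ → ℂ}

/-- Finitely supported families of level one forms of weights `k - w j`. -/
def coeffFun (w : J → ℤ) (k : ℤ) : Submodule ℂ (J →₀ (ℍ → ℂ)) where
  carrier := {r | ∀ j, r j ∈ modFun ⊤ (k - w j)}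
  add_mem' hr hs j := add_mem (hr j) (hs j)
  zero_mem' _ := zero_mem _
  smul_mem' c _ hr j := Submodule.smul_mem _ c (hr j)

lemma exists_linearCombination_eq
    (hspan : ∀ k, modFun Γ k ≤ decomposableFun Γ k ⊔ Submodule.span ℂ (b '' {j | w j = k}))
    {k : ℤ} {f : ℍ → ℂ} (hf : f ∈ modFun Γ k) :
    ∃ r ∈ coeffFun w k, Finsupp.linearCombination (ℍ → ℂ) b r = f := by
  classical
  let P : ℤ → Submodule ℂ (ℍ → ℂ) := fun k ↦
    (coeffFun w k).map ((Finsupp.linearCombination (ℍ → ℂ) b).restrictScalars ℂ)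
  have hmul : ∀ (e : ℍ → ℂ) (d k : ℤ), e ∈ modFun ⊤ d → ∀ s ∈ P (k - d), e * s ∈ P k := by
    rintro e d k he _ ⟨r, hr, rfl⟩
    refine ⟨e • r, fun j ↦ ?_, by simp⟩
    exact modFun_congr (by ring) (mul_mem_modFun he (hr j))
  suffices h : ∀ n : ℕ, ∀ k : ℤ, k < n → modFun Γ k ≤ P k by
    obtain ⟨r, hr, h⟩ := h (k.toNat + 1) k (by have := Int.self_le_toNat k; push_cast; omega) hf
    exact ⟨r, hr, h⟩
  intro n
  induction n with
  | zero =>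
    intro k hk f hf
    rw [eq_zero_of_neg (by simpa using hk) hf]
    exact zero_mem _
  | succ n ih =>
    intro k hk
    refine (hspan k).trans (sup_le ?_ (Submodule.span_le.2 ?_))
    · intro f hf
      obtain ⟨s, hs, t, ht, rfl⟩ := mem_decomposableFun.1 hf
      push_cast at hk
      exact add_mem (hmul _ 4 k E_four_mem _ (ih _ (by omega) hs))
        (hmul _ 6 k E_six_mem _ (ih _ (by omega) ht))
    · rintro _ ⟨j, rfl, rfl⟩
      refine ⟨Finsupp.single j 1, fun i ↦ ?_, by simp⟩
      by_cases h : i = j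
      · subst h
        rw [Finsupp.single_eq_same]
        exact modFun_congr (by simp) (const_mem_modFun (Γ := ⊤) 1)
      · rw [Finsupp.single_eq_of_ne (by simpa using h)]
        exact zero_mem _

omit [Γ.FiniteIndex] in
lemma linearCombination_mem (hb : ∀ j, b j ∈ modFun Γ (w j)) {k : ℤ} {r : J →₀ (ℍ → ℂ)}
    (hr : r ∈ coeffFun w k) : Finsupp.linearCombination (ℍ → ℂ) b r ∈ modFun Γ k := by
  rw [Finsupp.linearCombination_apply]
  exact sum_mem fun j _ ↦ modFun_congr (by ring)
    (mul_mem_modFun (modFun_mono le_top (hr j)) (hb j))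

lemma exists_level_one_decomposition {k : ℤ} {f : ℍ → ℂ} (hf : f ∈ modFun ⊤ k) :
    ∃ c : ℂ, ∃ s ∈ modFun ⊤ (k - 4), ∃ t ∈ modFun ⊤ (k - 6),
      f = Function.const ℍ c + E₄ * s + E₆ * t ∧ (c ≠ 0 → k = 0) ∧
        (f = 0 → c = 0 ∧ s = 0 ∧ t = 0) := by
  by_cases hf0 : f = 0
  · exact ⟨0, 0, zero_mem _, 0, zero_mem _, by simp [hf0], by simp, by simp⟩
  by_cases hk : k = 0
  · subst hk
    obtain ⟨c, rfl⟩ := eq_const_of_weight_zero hf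
    exact ⟨c, 0, zero_mem _, 0, zero_mem _, by simp, by simp, fun h ↦ absurd h hf0⟩
  · obtain ⟨s, hs, t, ht, h⟩ := exists_eq_E_four_mul_add_E_six_mul hk hf
    exact ⟨0, s, hs, t, ht, by rw [h]; ext; simp, by simp, fun h ↦ absurd h hf0⟩

lemma eq_zero_of_linearCombination_eq_zero (hb0 : ∀ j, b j ≠ 0)
    (hb : ∀ j, b j ∈ modFun Γ (w j)) (hind : ∀ k, LinearIndepOn ℂ b {j | w j = k})
    (hspan : ∀ k, modFun Γ k ≤ decomposableFun Γ k ⊔ Submodule.span ℂ (b '' {j | w j = k}))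
    (hdisj : ∀ k, Disjoint (decomposableFun Γ k) (Submodule.span ℂ (b '' {j | w j = k})))
    {k : ℤ} {r : J →₀ (ℍ → ℂ)} (hr : r ∈ coeffFun w k)
    (h : Finsupp.linearCombination (ℍ → ℂ) b r = 0) : r = 0 := by
  classical
  have hw : ∀ j, 0 ≤ w j := fun j ↦ by
    by_contra! hj
    exact hb0 j (eq_zero_of_neg hj (hb j))
  suffices H : ∀ n : ℕ, ∀ k : ℤ, k < n → ∀ r ∈ coeffFun w k,
      Finsupp.linearCombination (ℍ → ℂ) b r = 0 → r = 0 from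
    H (k.toNat + 1) k (by have := Int.self_le_toNat k; push_cast; omega) r hr h
  clear! k r
  intro n
  induction n with
  | zero =>
    intro k hk r hr _
    ext1 j
    refine eq_zero_of_neg ?_ (hr j)
    have := hw j
    simp at hk
    omega
  | succ n ih =>
    intro k hk r hr h
    push_cast at hk
    have hz : Function.const ℍ (0 : ℂ) = 0 := Function.const_zero
    choose c s hs t ht hrj hc hzero using fun j ↦ exists_level_one_decomposition (hr j)
    let c' := Finsupp.onFinset r.support c fun j hj ↦ Finsupp.mem_support_iff.2
      fun h ↦ hj (hzero j h).1
    let s' := Finsupp.onFinset r.support s fun j hj ↦ Finsupp.mem_support_iff.2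
      fun h ↦ hj (hzero j h).2.1
    let t' := Finsupp.onFinset r.support t fun j hj ↦ Finsupp.mem_support_iff.2
      fun h ↦ hj (hzero j h).2.2
    have hs' : s' ∈ coeffFun w (k - 4) := fun j ↦ modFun_congr (by ring) (hs j)
    have ht' : t' ∈ coeffFun w (k - 6) := fun j ↦ modFun_congr (by ring) (ht j)
    have hdec : r = c'.mapRange (Function.const ℍ) hz + (⇑E₄ : ℍ → ℂ) • s' +
        (⇑E₆ : ℍ → ℂ) • t' := Finsupp.ext hrj
    have hconst : Finsupp.linearCombination (ℍ → ℂ) b (c'.mapRange (Function.const ℍ) hz) =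
        Finsupp.linearCombination ℂ b c' := by
      rw [Finsupp.linearCombination_apply, Finsupp.linearCombination_apply,
        Finsupp.sum_mapRange_index (by simp)]
      rfl
    have hc' : c' ∈ Finsupp.supported ℂ ℂ {j | w j = k} := by
      intro j hj
      have : c j ≠ 0 := Finsupp.mem_support_iff.1 hj
      have := hc j this
      simp only [Set.mem_ofPred_eq]
      omega
    set S := Finsupp.linearCombination (ℍ → ℂ) b s' with hS
    set T := Finsupp.linearCombination (ℍ → ℂ) b t' with hT
    have hSm : S ∈ modFun Γ (k - 4) := linearCombination_mem hb hs'
    have hTm : T ∈ modFun Γ (k - 6) := linearCombination_mem hb ht'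
    have hsum : Finsupp.linearCombination ℂ b c' + (E₄ * S + E₆ * T) = 0 := by
      rw [← hconst, ← h, hdec]
      simp only [map_add, map_smul, smul_eq_mul, add_assoc, hS, hT]
    have hd : E₄ * S + E₆ * T ∈ decomposableFun Γ k := mem_decomposableFun.2 ⟨S, hSm, T, hTm, rfl⟩
    have hsp : E₄ * S + E₆ * T ∈ Submodule.span ℂ (b '' {j | w j = k}) := by
      rw [← neg_eq_of_add_eq_zero_right hsum]
      exact neg_mem ((Finsupp.mem_span_image_iff_linearCombination ℂ).2 ⟨c', hc', rfl⟩)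
    have hzero' := (Submodule.disjoint_def.1 (hdisj k)) _ hd hsp
    have hc0 : c' = 0 := linearIndepOn_iff.1 (hind k) c' hc' (by rwa [hzero', add_zero] at hsum)
    obtain ⟨u, hu, hu1, hu2⟩ := exists_eq_mul_of_E_four_mul_eq hSm (neg_mem hTm) (by ring)
      (by rw [mul_neg]; exact eq_neg_of_add_eq_zero_left hzero')
    obtain ⟨v, hv, rfl⟩ := exists_linearCombination_eq hspan hu
    have h1 : s' - (⇑E₆ : ℍ → ℂ) • v = 0 := by
      refine ih (k - 4) (by omega) _ (sub_mem hs' fun j ↦ ?_) ?_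
      · exact modFun_congr (by ring) (mul_mem_modFun E_six_mem (hv j))
      · rw [map_sub, map_smul, smul_eq_mul, ← hu1, sub_self]
    have h2 : t' + (⇑E₄ : ℍ → ℂ) • v = 0 := by
      refine ih (k - 6) (by omega) _ (add_mem ht' fun j ↦ ?_) ?_
      · exact modFun_congr (by ring) (mul_mem_modFun E_four_mem (hv j))
      · rw [map_add, map_smul, smul_eq_mul, ← hu2, add_neg_cancel]
    rw [hdec, hc0, sub_eq_zero.1 h1, eq_neg_of_add_eq_zero_left h2, smul_neg, smul_smul, smul_smul,
      mul_comm (⇑E₄ : ℍ → ℂ)]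
    simp [Finsupp.mapRange_zero]

end Free

section SlashMatrix

lemma mdifferentiable_det {ι : Type} [Fintype ι] [DecidableEq ι] {N : ℍ → Matrix ι ι ℂ}
    (hN : ∀ i j, MDiff fun τ ↦ N τ i j) : MDiff fun τ ↦ (N τ).det := by
  have : (fun τ ↦ (N τ).det) = ∑ σ : Equiv.Perm ι,
      Function.const ℍ ((Equiv.Perm.sign σ : ℤ) : ℂ) * ∏ i, fun τ ↦ N τ (σ i) i := by
    ext τ
    simp [Matrix.det_apply']
  rw [this]
  exact MDifferentiable.sum fun σ _ ↦ mdifferentiable_const.mul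
    (MDifferentiable.prod fun i _ ↦ hN _ _)

variable {p : ℕ} [Fact p.Prime] {u u' : Option (ZMod p) → ℤ} {a a' : Option (ZMod p) → ℍ → ℂ}

/-- The matrix of values at `τ` of the slash translates of the `a l` by coset representatives. -/
noncomputable def slashMatrix (u : Option (ZMod p) → ℤ) (a : Option (ZMod p) → ℍ → ℂ) (τ : ℍ) :
    Matrix (Option (ZMod p)) (Option (ZMod p)) ℂ :=
  .of fun i l ↦ (a l ∣[u l] cosetRep p i) τ

lemma slashMatrix_smul_mul_diagonal (ha : ∀ l, a l ∈ modFun (Gamma0 p) (u l)) (g : SL(2, ℤ))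
    (τ : ℍ) : slashMatrix u a (g • τ) * Matrix.diagonal (fun l ↦ denom g τ ^ (-u l)) =
      (slashMatrix u a τ).submatrix (cosetPerm p g) id := by
  ext i l
  rw [Matrix.mul_diagonal, Matrix.submatrix_apply, slashMatrix, slashMatrix, Matrix.of_apply,
    Matrix.of_apply, id, ← slash_cosetRep_slash (ha l).2.1]
  exact (SL_slash_apply (a l ∣[u l] cosetRep p i) g τ).symm

lemma prod_zpow_eq_zpow_sum {ι G : Type*} [CommGroupWithZero G] {x : G} (hx : x ≠ 0) (s : Finset ι)
    (n : ι → ℤ) : ∏ i ∈ s, x ^ n i = x ^ ∑ i ∈ s, n i := by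
  classical
  induction s using Finset.induction_on with
  | empty => simp
  | insert i s hi ih => rw [Finset.prod_insert hi, Finset.sum_insert hi, ih, zpow_add₀ hx]

lemma det_slashMatrix_slash (ha : ∀ l, a l ∈ modFun (Gamma0 p) (u l)) (g : SL(2, ℤ)) :
    (fun τ ↦ (slashMatrix u a τ).det) ∣[∑ l, u l] g =
      fun τ ↦ (Equiv.Perm.sign (cosetPerm p g) : ℂ) * (slashMatrix u a τ).det := by
  ext τ
  have h := congrArg Matrix.det (slashMatrix_smul_mul_diagonal ha g τ)
  rw [Matrix.det_permute, Matrix.det_mul, Matrix.det_diagonal,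
    prod_zpow_eq_zpow_sum (denom_ne_zero _ τ), Finset.sum_neg_distrib] at h
  rw [SL_slash_apply, h]

lemma det_slashMatrix_mul_mem (ha : ∀ l, a l ∈ modFun (Gamma0 p) (u l))
    (ha' : ∀ l, a' l ∈ modFun (Gamma0 p) (u' l)) :
    (fun τ ↦ (slashMatrix u a τ).det) * (fun τ ↦ (slashMatrix u' a' τ).det) ∈
      modFun ⊤ (∑ l, u l + ∑ l, u' l) := by
  have hdet : ∀ {u : Option (ZMod p) → ℤ} {a : Option (ZMod p) → ℍ → ℂ},
      (fun τ ↦ (slashMatrix u a τ).det) = ∑ σ : Equiv.Perm (Option (ZMod p)),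
        Function.const ℍ ((Equiv.Perm.sign σ : ℤ) : ℂ) * ∏ i, (a i ∣[u i] cosetRep p (σ i)) := by
    intro u a
    ext τ
    simp [Matrix.det_apply', slashMatrix]
  have hmd : ∀ {u : Option (ZMod p) → ℤ} {a : Option (ZMod p) → ℍ → ℂ},
      (∀ l, a l ∈ modFun (Gamma0 p) (u l)) → MDiff (fun τ ↦ (slashMatrix u a τ).det) :=
    fun ha ↦ mdifferentiable_det fun i l ↦ (ha l).1.slash _ _
  have hbd : ∀ {u : Option (ZMod p) → ℤ} {a : Option (ZMod p) → ℍ → ℂ},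
      (∀ l, a l ∈ modFun (Gamma0 p) (u l)) →
        (fun τ ↦ (slashMatrix u a τ).det) ∈ boundedFilterSubalgebra ℂ atImInfty := by
    intro u a ha
    rw [hdet]
    refine sum_mem fun σ _ ↦ mul_mem (const_boundedAtFilter _ _) ?_
    exact prod_mem fun i _ ↦ (ha i).2.2 _
  have hinv : ∀ g : SL(2, ℤ), ((fun τ ↦ (slashMatrix u a τ).det) *
      (fun τ ↦ (slashMatrix u' a' τ).det)) ∣[∑ l, u l + ∑ l, u' l] g =
        (fun τ ↦ (slashMatrix u a τ).det) * (fun τ ↦ (slashMatrix u' a' τ).det) := by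
    intro g
    rw [mul_slash_SL2, det_slashMatrix_slash ha, det_slashMatrix_slash ha']
    ext τ
    have : ((Equiv.Perm.sign (cosetPerm p g) : ℤ) : ℂ) *
        (Equiv.Perm.sign (cosetPerm p g) : ℤ) = 1 := by
      rw [← Int.cast_mul, ← Units.val_mul, Int.units_mul_self]; simp
    simp only [Pi.mul_apply]
    linear_combination (slashMatrix u a τ).det * (slashMatrix u' a' τ).det * this
  refine ⟨(hmd ha).mul (hmd ha'), fun g _ ↦ hinv g, fun g ↦ ?_⟩
  rw [hinv]
  exact (boundedFilterSubalgebra ℂ atImInfty).mul_mem (hbd ha) (hbd ha')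

end SlashMatrix

section Basis

lemma exists_det_ne_zero_of_spanning {ι J : Type} [Fintype ι] [DecidableEq ι] (V : J → ι → ℂ)
    (hV : ∀ v : ι → ℂ, (∀ j, ∑ i, v i * V j i = 0) → v = 0) :
    ∃ e : ι → J, Function.Injective e ∧ (Matrix.of fun i l ↦ V (e l) i).det ≠ 0 := by
  have htop : Submodule.span ℂ (Set.range V) = ⊤ := by
    by_contra h
    obtain ⟨f, hf, hle⟩ := Submodule.exists_le_ker_of_lt_top _ (lt_top_iff_ne_top.2 h)
    refine hf (LinearMap.pi_ext' fun i ↦ LinearMap.ext_ring ?_)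
    have hrep : ∀ x : ι → ℂ, f x = ∑ i, f (Pi.single i 1) * x i := fun x ↦ by
      conv_lhs => rw [← Finset.univ_sum_single x, map_sum]
      refine Finset.sum_congr rfl fun i _ ↦ ?_
      rw [mul_comm, ← smul_eq_mul, ← map_smul, ← Pi.single_smul, smul_eq_mul, mul_one]
    have h0 := hV (fun i ↦ f (Pi.single i 1)) fun j ↦ by
      rw [← hrep]
      exact hle (Submodule.subset_span ⟨j, rfl⟩)
    simpa using congrFun h0 i
  obtain ⟨κ, a, ha, hspan, hli⟩ := exists_linearIndependent' ℂ V
  let B := Module.Basis.mk hli (by rw [hspan, htop])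
  let ε : ι ≃ κ := (Pi.basisFun ℂ ι).indexEquiv B
  refine ⟨a ∘ ε, ha.comp ε.injective, ?_⟩
  have hli' : LinearIndependent ℂ fun l ↦ V (a (ε l)) := hli.comp ε ε.injective
  have : (Matrix.of fun i l ↦ V (a (ε l)) i) = (Matrix.of fun l i ↦ V (a (ε l)) i).transpose := rfl
  change (Matrix.of fun i l ↦ V (a (ε l)) i).det ≠ 0
  rw [this, Matrix.det_transpose, ← isUnit_iff_ne_zero, ← Matrix.isUnit_iff_isUnit_det,
    ← Matrix.linearIndependent_rows_iff_isUnit]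
  exact hli'

variable (p : ℕ) [Fact p.Prime]

/-- The modular forms for `Γ₀(p)` are a free module of rank `p + 1` over level one forms. -/
theorem exists_basis_Gamma0 : ∃ (w : Option (ZMod p) → ℤ) (b : Option (ZMod p) → ℍ → ℂ),
    (∀ l, b l ∈ modFun (Gamma0 p) (w l)) ∧
    (∀ k, ∀ f ∈ modFun (Gamma0 p) k, ∃ r : Option (ZMod p) → ℍ → ℂ,
      (∀ l, r l ∈ modFun ⊤ (k - w l)) ∧ ∑ l, r l * b l = f) ∧
    (∀ k, ∀ r : Option (ZMod p) → ℍ → ℂ, (∀ l, r l ∈ modFun ⊤ (k - w l)) →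
      ∑ l, r l * b l = 0 → r = 0) := by
  classical
  obtain ⟨J, w, b, hb0, hb, hind, hspan, hdisj⟩ := exists_indecomposable_family (Gamma0 p)
  obtain ⟨e, he, hdet⟩ := exists_det_ne_zero_of_spanning
    (fun j i ↦ (b j ∣[w j] cosetRep p i) UpperHalfPlane.I) (fun v hv ↦ by
    refine eq_zero_of_forall_sum_eq_zero UpperHalfPlane.I v fun k f hf ↦ ?_
    obtain ⟨r, hr, rfl⟩ := exists_linearCombination_eq hspan hf
    have hterm : ∀ i, (Finsupp.linearCombination (ℍ → ℂ) b r ∣[k] cosetRep p i) UpperHalfPlane.I =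
        ∑ j ∈ r.support, r j UpperHalfPlane.I * (b j ∣[w j] cosetRep p i) UpperHalfPlane.I := by
      intro i
      rw [Finsupp.linearCombination_apply, Finsupp.sum, SlashAction.sum_slash, Finset.sum_apply]
      refine Finset.sum_congr rfl fun j _ ↦ ?_
      have : (r j * b j) ∣[k] cosetRep p i = r j * (b j ∣[w j] cosetRep p i) := by
        conv_lhs => rw [show k = (k - w j) + w j by ring, mul_slash_SL2,
          (hr j).2.1 _ (Subgroup.mem_top _)]
      rw [smul_eq_mul, this, Pi.mul_apply]
    simp_rw [hterm, Finset.mul_sum]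
    rw [Finset.sum_comm]
    refine Finset.sum_eq_zero fun j _ ↦ ?_
    simp_rw [mul_left_comm _ (r j UpperHalfPlane.I)]
    rw [← Finset.mul_sum, hv j, mul_zero])
  have hsurj : Function.Surjective e := by
    intro j₀
    by_contra! hj₀
    set M := slashMatrix (w ∘ e) (b ∘ e) with hM
    set D : ℍ → ℂ := fun τ ↦ (M τ).det with hD
    set u' : Option (ZMod p) → Option (ZMod p) → ℤ := fun l ↦ Function.update (w ∘ e) l (w j₀)
    set a' : Option (ZMod p) → Option (ZMod p) → ℍ → ℂ := fun l ↦
      Function.update (b ∘ e) l (b j₀)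
    have ha : ∀ l, (b ∘ e) l ∈ modFun (Gamma0 p) ((w ∘ e) l) := fun l ↦ hb _
    have ha' : ∀ l l', a' l l' ∈ modFun (Gamma0 p) (u' l l') := by
      intro l l'
      by_cases h : l' = l
      · subst h; simpa [a', u'] using hb j₀
      · simpa [a', u', h] using hb (e l')
    set D' : Option (ZMod p) → ℍ → ℂ := fun l τ ↦ (slashMatrix (u' l) (a' l) τ).det with hD'
    have hcramer : ∑ l, D' l * b (e l) = D * b j₀ := by
      ext τ
      have h := congrFun (Matrix.mulVec_cramer (M τ)
        (fun i ↦ (b j₀ ∣[w j₀] cosetRep p i) τ)) none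
      simp only [Finset.sum_apply, Pi.mul_apply]
      rw [Pi.smul_apply, smul_eq_mul, cosetRep_none, SlashAction.slash_one] at h
      rw [hD, ← h, Matrix.mulVec, dotProduct]
      refine Finset.sum_congr rfl fun l _ ↦ ?_
      rw [mul_comm, Matrix.cramer_apply]
      congr 1
      · simp [hM, slashMatrix, cosetRep_none]
      · rw [hD']
        refine congrArg Matrix.det (Matrix.ext fun i l' ↦ ?_)
        by_cases h : l' = l
        · subst h; simp [slashMatrix, a', u']
        · simp [slashMatrix, a', u', h, hM]
    set U := ∑ l, (w ∘ e) l
    have hu' : ∀ l, ∑ l', u' l l' = U - w (e l) + w j₀ := by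
      intro l
      have := Finset.sum_erase_add _ (w ∘ e) (Finset.mem_univ l)
      rw [Finset.sum_update_of_mem (Finset.mem_univ l), Finset.sdiff_singleton_eq_erase]
      simp only [U, ← this, Function.comp_apply]
      ring
    set r : J →₀ (ℍ → ℂ) := ∑ l, Finsupp.single (e l) (D * D' l) - Finsupp.single j₀ (D * D) with hr
    have hrmem : r ∈ coeffFun w (U + U + w j₀) := by
      refine sub_mem (sum_mem fun l _ j ↦ ?_) fun j ↦ ?_
      · by_cases h : j = e l
        · subst h
          rw [Finsupp.single_eq_same]
          exact modFun_congr (by rw [hu']; ring) (det_slashMatrix_mul_mem ha (ha' l))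
        · rw [Finsupp.single_eq_of_ne h]
          exact zero_mem _
      · by_cases h : j = j₀
        · subst h
          rw [Finsupp.single_eq_same]
          exact modFun_congr (by ring) (det_slashMatrix_mul_mem ha ha)
        · rw [Finsupp.single_eq_of_ne h]
          exact zero_mem _
    have hr0 : r = 0 := by
      refine eq_zero_of_linearCombination_eq_zero hb0 hb hind hspan hdisj hrmem ?_
      rw [hr, map_sub, map_sum]
      simp only [Finsupp.linearCombination_single, smul_eq_mul, mul_assoc]
      rw [← Finset.mul_sum, hcramer, sub_self]
    have h0 : -(D * D) = 0 := by
      have := DFunLike.congr_fun hr0 j₀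
      rw [hr, Finsupp.sub_apply, Finsupp.finsetSum_apply, Finset.sum_eq_zero, zero_sub,
        Finsupp.single_eq_same] at this
      · exact this
      · exact fun l _ ↦ Finsupp.single_eq_of_ne (by simpa [eq_comm] using hj₀ l)
    have := congrFun h0 UpperHalfPlane.I
    simp only [Pi.neg_apply, Pi.mul_apply, Pi.zero_apply, neg_eq_zero, mul_self_eq_zero] at this
    exact hdet this
  let ε := Equiv.ofBijective e ⟨he, hsurj⟩
  refine ⟨w ∘ ε, b ∘ ε, fun l ↦ hb _, fun k f hf ↦ ?_, fun k r hr h ↦ ?_⟩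
  · obtain ⟨r, hr, rfl⟩ := exists_linearCombination_eq hspan hf
    refine ⟨fun l ↦ r (ε l), fun l ↦ hr _, ?_⟩
    rw [Finsupp.linearCombination_apply,
      Finsupp.sum_of_support_subset r (s := Finset.univ.map ε.toEmbedding)]
    · simp
    · intro j _
      simp
    · simp
  · let r' : J →₀ (ℍ → ℂ) := Finsupp.equivFunOnFinite.symm r |>.equivMapDomain ε
    have hr' : r' = 0 := by
      refine eq_zero_of_linearCombination_eq_zero hb0 hb hind hspan hdisj (k := k)
        (fun j ↦ ?_) ?_
      · simpa [r'] using hr (ε.symm j)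
      · rw [← h, Finsupp.linearCombination_equivMapDomain, Finsupp.linearCombination_apply,
          Finsupp.sum_fintype _ _ (by simp)]
        simp
    ext1 l
    simpa [r'] using DFunLike.congr_fun hr' (ε l)

end Basis

section LevelRaise

variable {k : ℤ} {f : ℍ → ℂ}

/-- The real matrix with rows `(a, b)` and `(0, d)`. -/
noncomputable def upperGL (a b d : ℝ) (ha : 0 < a) (hd : 0 < d) : GL (Fin 2) ℝ :=
  Matrix.GeneralLinearGroup.mkOfDetNeZero !![a, b; 0, d] (by simp [ha.ne', hd.ne'])

lemma upperGL_one_zero {a b d : ℝ} (ha : 0 < a) (hd : 0 < d) : upperGL a b d ha hd 1 0 = 0 := by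
  simp [upperGL, Matrix.GeneralLinearGroup.mkOfDetNeZero]

lemma coe_upperGL_smul {a b d : ℝ} (ha : 0 < a) (hd : 0 < d) (τ : ℍ) :
    ((upperGL a b d ha hd • τ : ℍ) : ℂ) = (a * τ + b) / d := by
  rw [coe_smul_of_det_pos]
  · simp [upperGL, num, denom, Matrix.GeneralLinearGroup.mkOfDetNeZero]
  · simp [upperGL, Matrix.GeneralLinearGroup.mkOfDetNeZero]; positivity

lemma slash_upperGL_apply {a b d : ℝ} (ha : 0 < a) (hd : 0 < d) (τ : ℍ) :
    (f ∣[k] upperGL a b d ha hd) τ =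
      f (upperGL a b d ha hd • τ) * (a * d : ℂ) ^ (k - 1) * (d : ℂ) ^ (-k) := by
  have hdet : (upperGL a b d ha hd).det.val = a * d := by
    simp [upperGL, Matrix.GeneralLinearGroup.mkOfDetNeZero]
  rw [slash_apply, hdet, abs_of_pos (by positivity)]
  simp [σ, mul_pos ha hd, denom, upperGL, Matrix.GeneralLinearGroup.mkOfDetNeZero]

lemma tendsto_upperGL_smul {a b d : ℝ} (ha : 0 < a) (hd : 0 < d) :
    Tendsto (fun τ ↦ upperGL a b d ha hd • τ) atImInfty atImInfty := by
  have him : ∀ τ : ℍ, (upperGL a b d ha hd • τ).im = a / d * τ.im := fun τ ↦ by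
    rw [← coe_im, coe_upperGL_smul, Complex.div_ofReal_im]
    simp
    ring
  rw [atImInfty, tendsto_comap_iff]
  simp only [Function.comp_def, him]
  exact (tendsto_comap).const_mul_atTop (by positivity)

variable (p : ℕ) [hp : Fact p.Prime]

lemma natCast_pos_of_fact : (0 : ℝ) < p := by exact_mod_cast hp.out.pos

/-- The operator sending `f` to a multiple of `f(p ·)`. -/
noncomputable def levelRaise (k : ℤ) (f : ℍ → ℂ) : ℍ → ℂ :=
  f ∣[k] upperGL p 0 1 (natCast_pos_of_fact p) one_pos

lemma levelRaise_slash_some (hf : ∀ γ : SL(2, ℤ), f ∣[k] γ = f) (j : ZMod p) :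
    levelRaise p k f ∣[k] cosetRep p (some j) =
      f ∣[k] upperGL 1 (j.val) p one_pos (natCast_pos_of_fact p) := by
  conv_rhs => rw [← hf ModularGroup.S]
  rw [levelRaise, SL_slash, SL_slash, ← SlashAction.slash_mul, ← SlashAction.slash_mul]
  congr 1
  ext i j
  fin_cases i <;> fin_cases j <;>
    simp [upperGL, cosetRep_some_apply, Matrix.GeneralLinearGroup.mkOfDetNeZero, Matrix.mul_apply,
      Fin.sum_univ_two, ModularGroup.coe_S]

lemma levelRaise_slash_Gamma0 (hf : ∀ γ : SL(2, ℤ), f ∣[k] γ = f) {γ : SL(2, ℤ)}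
    (hγ : γ ∈ Gamma0 p) : levelRaise p k f ∣[k] γ = levelRaise p k f := by
  rw [Gamma0_mem, ZMod.intCast_zmod_eq_zero_iff_dvd] at hγ
  obtain ⟨c, hc⟩ := hγ
  let γ' : SL(2, ℤ) := ⟨!![γ 0 0, p * γ 0 1; c, γ 1 1], by
    have := γ.det_coe
    rw [Matrix.det_fin_two, hc] at this
    rw [Matrix.det_fin_two_of]
    linear_combination this⟩
  have h00 : γ' 0 0 = γ 0 0 := rfl
  have h01 : γ' 0 1 = p * γ 0 1 := rfl
  have h10 : γ' 1 0 = c := rfl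
  have h11 : γ' 1 1 = γ 1 1 := rfl
  clear_value γ'
  conv_rhs => rw [levelRaise, ← hf γ']
  rw [levelRaise, SL_slash, SL_slash, ← SlashAction.slash_mul, ← SlashAction.slash_mul]
  congr 1
  ext i j
  fin_cases i <;> fin_cases j <;>
    simp [upperGL, h00, h01, h10, h11, hc, Matrix.GeneralLinearGroup.mkOfDetNeZero,
      Matrix.mul_apply, Fin.sum_univ_two, mul_comm]

lemma levelRaise_mem (hf : f ∈ modFun ⊤ k) : levelRaise p k f ∈ modFun (Gamma0 p) k := by
  have hb : IsBoundedAtImInfty f := by simpa using hf.2.2 1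
  have hinv := fun γ ↦ hf.2.1 γ (Subgroup.mem_top γ)
  refine ⟨hf.1.slash _ _, fun γ hγ ↦ levelRaise_slash_Gamma0 p hinv hγ, fun γ ↦ ?_⟩
  rw [slash_eq_cosetRep (fun γ hγ ↦ levelRaise_slash_Gamma0 p hinv hγ) γ]
  obtain h | ⟨j, h⟩ := (cosetCls p γ).eq_none_or_eq_some
  · rw [h, cosetRep_none, SlashAction.slash_one]
    exact hb.slash _ (upperGL_one_zero _ _)
  · rw [h, levelRaise_slash_some p hinv]
    exact hb.slash _ (upperGL_one_zero _ _)

lemma levelRaise_slash_none_apply (τ : ℍ) : (levelRaise p k f ∣[k] cosetRep p none) τ =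
    (p : ℂ) ^ (k - 1) * f (upperGL p 0 1 (natCast_pos_of_fact p) one_pos • τ) := by
  rw [cosetRep_none, SlashAction.slash_one, levelRaise, slash_upperGL_apply]
  simp [mul_comm]

lemma levelRaise_slash_some_apply (hf : ∀ γ : SL(2, ℤ), f ∣[k] γ = f) (j : ZMod p) (τ : ℍ) :
    (levelRaise p k f ∣[k] cosetRep p (some j)) τ =
      (p : ℂ)⁻¹ * f (upperGL 1 (j.val) p one_pos (natCast_pos_of_fact p) • τ) := by
  have hp0 : (p : ℂ) ≠ 0 := by exact_mod_cast hp.out.ne_zero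
  rw [levelRaise_slash_some p hf, slash_upperGL_apply, mul_assoc, mul_comm]
  congr 1
  simp only [Complex.ofReal_one, one_mul, Complex.ofReal_natCast]
  rw [← zpow_add₀ hp0, ← zpow_neg_one]
  congr 1
  ring

lemma tendsto_levelRaise_slash_none {c : ℂ} (hc : Tendsto f atImInfty (𝓝 c)) :
    Tendsto (levelRaise p k f ∣[k] cosetRep p none) atImInfty (𝓝 ((p : ℂ) ^ (k - 1) * c)) := by
  simp only [funext (levelRaise_slash_none_apply (f := f) (k := k) p)]
  exact (hc.comp (tendsto_upperGL_smul _ _)).const_mul _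

lemma tendsto_levelRaise_slash_some (hf : ∀ γ : SL(2, ℤ), f ∣[k] γ = f) {c : ℂ}
    (hc : Tendsto f atImInfty (𝓝 c)) (j : ZMod p) :
    Tendsto (levelRaise p k f ∣[k] cosetRep p (some j)) atImInfty (𝓝 ((p : ℂ)⁻¹ * c)) := by
  simp only [funext (levelRaise_slash_some_apply (f := f) (k := k) p hf j)]
  exact (hc.comp (tendsto_upperGL_smul _ _)).const_mul _

end LevelRaise

section CuspTest

local notation "Δ" => ModularForm.discriminant
local notation "𝕢" => Function.Periodic.qParam

lemma tendsto_zero_of_tendsto_mulVec {ι α : Type*} [Fintype ι] [DecidableEq ι] {l : Filter α}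
    {A : α → Matrix ι ι ℂ} {L : Matrix ι ι ℂ} (hA : ∀ i j, Tendsto (A · i j) l (𝓝 (L i j)))
    (hL : L.det ≠ 0) {x : α → ι → ℂ}
    (hx : ∀ i, Tendsto (fun a ↦ ((A a).mulVec (x a)) i) l (𝓝 0)) (i : ι) :
    Tendsto (fun a ↦ x a i) l (𝓝 0) := by
  have hA' : Tendsto A l (𝓝 L) := tendsto_pi_nhds.2 fun i ↦ tendsto_pi_nhds.2 (hA i)
  have hdet : Tendsto (fun a ↦ (A a).det) l (𝓝 L.det) :=
    ((continuous_id.matrix_det).tendsto L).comp hA'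
  have hadj : ∀ i j, Tendsto (fun a ↦ (A a).adjugate i j) l (𝓝 (L.adjugate i j)) := fun i j ↦
    ((continuous_id.matrix_adjugate.matrix_elem i j).tendsto L).comp hA'
  have hsum : Tendsto (fun a ↦ ((A a).det)⁻¹ * ∑ j, (A a).adjugate i j * ((A a).mulVec (x a)) j) l
      (𝓝 0) := by
    have := (hdet.inv₀ hL).mul (tendsto_finsetSum Finset.univ fun j _ ↦ (hadj i j).mul (hx j))
    simpa using this
  refine hsum.congr' ?_
  filter_upwards [hdet.eventually_ne hL] with a ha
  have h := congrFun (congrArg (Matrix.mulVec · (x a)) (Matrix.adjugate_mul (A a))) i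
  simp only [← Matrix.mulVec_mulVec, Matrix.smul_mulVec, Matrix.one_mulVec, Pi.smul_apply,
    smul_eq_mul] at h
  rw [Matrix.mulVec, dotProduct] at h
  rw [h, inv_mul_cancel_left₀ ha]

lemma tendsto_discriminant_div_qParam :
    Tendsto (fun τ : ℍ ↦ Δ τ / 𝕢 1 τ) atImInfty (𝓝 1) := by
  refine tendsto_atImInfty_tprod_one_sub_eta_q_pow.congr fun τ ↦ ?_
  rw [discriminant_eq_q_prod, mul_div_cancel_left₀ _ (Function.Periodic.qParam_ne_zero _)]

lemma pow_slash_SL2 {k : ℤ} (f : ℍ → ℂ) (g : SL(2, ℤ)) (n : ℕ) :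
    (f ^ n) ∣[(n : ℤ) * k] g = (f ∣[k] g) ^ n := by
  induction n with
  | zero =>
    simp only [pow_zero, Nat.cast_zero, zero_mul]
    exact is_invariant_one g
  | succ n ih =>
    rw [pow_succ, pow_succ, ← ih, ← mul_slash_SL2]
    congr 1
    push_cast
    ring

variable (p : ℕ) [hp : Fact p.Prime]

/-- Limits at infinity of the translates of `levelRaise p 12 Δ`, divided by `𝕢 p`. -/
noncomputable def cuspNode : Option (ZMod p) → ℂ
  | none => 0
  | some j => (p : ℂ)⁻¹ * Complex.exp (2 * Real.pi * Complex.I / p) ^ j.val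

lemma tendsto_levelRaise_discriminant_div (i : Option (ZMod p)) :
    Tendsto (fun τ : ℍ ↦ (levelRaise p 12 Δ ∣[(12 : ℤ)] cosetRep p i) τ / 𝕢 p τ) atImInfty
      (𝓝 (cuspNode p i)) := by
  have hp0 : (p : ℂ) ≠ 0 := by exact_mod_cast hp.out.ne_zero
  have hp' : (0 : ℝ) < p := natCast_pos_of_fact p
  have hinv := fun γ ↦ discriminant_mem_cuspFun.2.1 γ (Subgroup.mem_top γ)
  obtain _ | j := i
  · have h1 := (tendsto_discriminant_div_qParam.comp
      (tendsto_upperGL_smul (b := 0) hp' one_pos)).const_mul ((p : ℂ) ^ (12 - 1 : ℤ))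
    have h2 : Tendsto (fun τ : ℍ ↦ 𝕢 p τ ^ (p ^ 2 - 1)) atImInfty (𝓝 0) := by
      have h3 := (qParam_tendsto_atImInfty hp').pow (p ^ 2 - 1)
      rwa [zero_pow] at h3
      have := Nat.pow_le_pow_left hp.out.two_le 2
      omega
    have h3 := h1.mul h2
    rw [mul_zero] at h3
    refine h3.congr fun τ ↦ ?_
    rw [levelRaise_slash_none_apply]
    have hq : 𝕢 1 (upperGL p 0 1 hp' one_pos • τ : ℍ) = 𝕢 p τ * 𝕢 p τ ^ (p ^ 2 - 1) := by
      rw [mul_pow_sub_one (by simp [hp.out.ne_zero]), Function.Periodic.qParam,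
        Function.Periodic.qParam, ← Complex.exp_nat_mul, coe_upperGL_smul]
      congr 1
      push_cast
      field_simp
      simp
    have hne : ∀ h z, 𝕢 h z ≠ 0 := fun h z ↦ Complex.exp_ne_zero _
    have hne' : 𝕢 p τ ^ (p ^ 2 - 1) ≠ 0 := pow_ne_zero _ (hne _ _)
    simp only [Function.comp_apply, hq]
    have := hne p τ
    field_simp
  · have h1 := ((tendsto_discriminant_div_qParam.comp
      (tendsto_upperGL_smul (b := j.val) one_pos hp')).const_mul ((p : ℂ)⁻¹)).mul_const
        (Complex.exp (2 * Real.pi * Complex.I / p) ^ j.val)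
    rw [mul_one] at h1
    refine h1.congr fun τ ↦ ?_
    rw [levelRaise_slash_some_apply p hinv]
    have hq : 𝕢 1 (upperGL 1 j.val p one_pos hp' • τ : ℍ) =
        𝕢 p τ * Complex.exp (2 * Real.pi * Complex.I / p) ^ j.val := by
      rw [Function.Periodic.qParam, Function.Periodic.qParam, ← Complex.exp_nat_mul,
        ← Complex.exp_add, coe_upperGL_smul]
      congr 1
      push_cast
      field_simp
    have hne : 𝕢 p τ ≠ 0 := Complex.exp_ne_zero _
    have hne' : Complex.exp (2 * Real.pi * Complex.I / p) ≠ 0 := Complex.exp_ne_zero _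
    simp only [Function.comp_apply, hq]
    field_simp

lemma eq_zero_of_cuspNode {x : Option (ZMod p) → ℂ} (h0 : x none = 0)
    (h : ∀ n < p, ∑ i, cuspNode p i ^ n * x i = 0) : x = 0 := by
  have hp0 : (p : ℂ) ≠ 0 := by exact_mod_cast hp.out.ne_zero
  have hinj : Function.Injective fun j : ZMod p ↦ cuspNode p (some j) := by
    intro i j hij
    have := mul_left_cancel₀ (inv_ne_zero hp0) hij
    exact ZMod.val_injective p ((Complex.isPrimitiveRoot_exp p hp.out.ne_zero).pow_inj
      (ZMod.val_lt _) (ZMod.val_lt _) this)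
  have e : Fin p ≃ ZMod p := Fintype.equivOfCardEq (by simp [ZMod.card])
  have hz : (fun n ↦ x (some (e n))) = 0 := by
    refine Matrix.eq_zero_of_forall_pow_sum_mul_pow_eq_zero
      (f := fun n ↦ cuspNode p (some (e n))) (hinj.comp e.injective) fun n ↦ ?_
    have := h n n.2
    rw [Fintype.sum_option, h0, mul_zero, zero_add, ← e.sum_comp] at this
    simpa only [mul_comm] using this
  ext i
  obtain _ | j := i
  · exact h0
  · simpa using congrFun hz (e.symm j)

/-- A criterion for a vector of functions to vanish at infinity, by pairing with modular forms. -/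
lemma tendsto_zero_of_forall_modFun {x : Option (ZMod p) → ℍ → ℂ}
    (hx : ∀ k : ℤ, ∀ h ∈ modFun (Gamma0 p) k, ∃ r : ℍ → ℂ, IsBoundedAtImInfty r ∧
      ∀ τ, ∑ i, (h ∣[k] cosetRep p i) τ * x i τ = Δ τ * r τ) (i : Option (ZMod p)) :
    Tendsto (x i) atImInfty (𝓝 0) := by
  have hp0 : (p : ℂ) ≠ 0 := by exact_mod_cast hp.out.ne_zero
  have hp' : (0 : ℝ) < p := natCast_pos_of_fact p
  have hne : ∀ h z, 𝕢 h z ≠ 0 := fun h z ↦ Function.Periodic.qParam_ne_zero _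
  set e : ℍ → ℂ := levelRaise p 4 E₄ - (p : ℂ)⁻¹ • E₄ with he
  have hem : e ∈ modFun (Gamma0 p) 4 := sub_mem (levelRaise_mem p E_four_mem)
    (Submodule.smul_mem _ _ (modFun_mono le_top E_four_mem))
  have hE4 := fun γ ↦ E_four_mem.2.1 γ (Subgroup.mem_top γ)
  have hes : ∀ i, e ∣[(4 : ℤ)] cosetRep p i =
      levelRaise p 4 E₄ ∣[(4 : ℤ)] cosetRep p i - (p : ℂ)⁻¹ • E₄ := fun i ↦ by
    rw [he, sub_eq_add_neg, SlashAction.add_slash, SlashAction.neg_slash, SL_smul_slash, hE4,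
      ← sub_eq_add_neg]
  let A : ℍ → Matrix (Option (ZMod p)) (Option (ZMod p)) ℂ := fun τ ↦ .of fun j i ↦
    j.elim ((e ∣[(4 : ℤ)] cosetRep p i) τ)
      fun j ↦ ((levelRaise p 12 Δ ∣[(12 : ℤ)] cosetRep p i) τ / 𝕢 p τ) ^ j.val
  let L : Matrix (Option (ZMod p)) (Option (ZMod p)) ℂ := .of fun j i ↦
    j.elim (if i = none then (p : ℂ) ^ (4 - 1 : ℤ) - (p : ℂ)⁻¹ else 0) fun j ↦ cuspNode p i ^ j.val
  refine tendsto_zero_of_tendsto_mulVec (A := A) (L := L) ?_ ?_ ?_ i (x := fun τ i ↦ x i τ)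
  · rintro (_ | j) i
    · simp only [A, L, Matrix.of_apply, Option.elim_none, hes]
      obtain _ | i := i
      · have := (tendsto_levelRaise_slash_none (k := 4) p tendsto_E_four).sub
          (tendsto_E_four.const_mul ((p : ℂ)⁻¹))
        simpa using! this
      · have := (tendsto_levelRaise_slash_some p hE4 tendsto_E_four i).sub
          (tendsto_E_four.const_mul ((p : ℂ)⁻¹))
        simpa using! this
    · exact (tendsto_levelRaise_discriminant_div p i).pow _
  · intro hdet
    obtain ⟨v, hv, hv0⟩ := Matrix.exists_mulVec_eq_zero_iff.2 hdet
    refine hv (eq_zero_of_cuspNode p ?_ fun n hn ↦ ?_)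
    · have := congrFun hv0 none
      simp [L, Matrix.mulVec, dotProduct] at this
      refine this.resolve_left fun h ↦ ?_
      have h1 : (p : ℂ) ^ 4 = 1 := by
        have h2 : (p : ℂ) ^ 3 = (p : ℂ)⁻¹ := by exact_mod_cast sub_eq_zero.1 h
        rw [pow_succ, h2, inv_mul_cancel₀ hp0]
      have h2 : p ^ 4 = 1 := by exact_mod_cast h1
      exact hp.out.one_lt.ne' ((Nat.pow_eq_one.1 h2).resolve_right (by norm_num))
    · have := congrFun hv0 (some (n : ZMod p))
      simpa [L, Matrix.mulVec, dotProduct, ZMod.val_cast_of_lt hn] using this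
  · rintro (_ | j)
    · obtain ⟨r, hr, h⟩ := hx 4 e hem
      have hz := isZeroAtImInfty_mul hr discriminant_isZeroAtImInfty
      refine Tendsto.congr (fun τ ↦ ?_) hz
      simp only [A, Matrix.mulVec, dotProduct, Matrix.of_apply, Option.elim_none, Pi.mul_apply]
      rw [h, mul_comm]
    · obtain ⟨r, hr, h⟩ := hx _ _ (pow_mem_modFun (levelRaise_mem p
        (cuspFun_le_modFun discriminant_mem_cuspFun)) j.val)
      have hz : IsZeroAtImInfty fun τ : ℍ ↦ Δ τ / 𝕢 p τ ^ j.val := by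
        have h1 := tendsto_discriminant_div_qParam.mul
          ((qParam_tendsto_atImInfty hp').pow (p - j.val))
        rw [zero_pow (Nat.sub_ne_zero_of_lt (ZMod.val_lt j)), mul_zero] at h1
        refine Tendsto.congr (fun τ ↦ ?_) h1
        have hq : 𝕢 1 τ = 𝕢 p τ ^ (p - j.val) * 𝕢 p τ ^ j.val := by
          rw [← pow_add, Nat.sub_add_cancel (ZMod.val_lt j).le, Function.Periodic.qParam,
            Function.Periodic.qParam, ← Complex.exp_nat_mul]
          congr 1
          push_cast
          field_simp
        rw [hq]
        have h1 := pow_ne_zero (p - j.val) (hne p τ)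
        have h2 := pow_ne_zero j.val (hne p τ)
        field_simp
      refine Tendsto.congr (fun τ ↦ ?_) (isZeroAtImInfty_mul hr hz)
      simp only [A, Matrix.mulVec, dotProduct, Matrix.of_apply, Option.elim_some, Pi.mul_apply]
      have h' := h τ
      simp only [pow_slash_SL2, Pi.pow_apply] at h'
      simp only [div_pow, div_mul_eq_mul_div]
      rw [← Finset.sum_div, h']
      ring

end CuspTest

section Dual

local notation "Δ" => ModularForm.discriminant

variable {p : ℕ} [hp : Fact p.Prime] {w : Option (ZMod p) → ℤ} {b : Option (ZMod p) → ℍ → ℂ}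

lemma mul_slash_of_mem_top {k k₁ k₂ : ℤ} (hk : k = k₁ + k₂) {f : ℍ → ℂ} (hf : f ∈ modFun ⊤ k₁)
    (g : ℍ → ℂ) (γ : SL(2, ℤ)) : (f * g) ∣[k] γ = f * (g ∣[k₂] γ) := by
  rw [hk, mul_slash_SL2, hf.2.1 _ (Subgroup.mem_top _)]

lemma sum_mul_slash {k : ℤ} {r : Option (ZMod p) → ℍ → ℂ} {f : ℍ → ℂ}
    (hr : ∀ l, r l ∈ modFun ⊤ (k - w l)) (h : ∑ l, r l * b l = f) (i : Option (ZMod p)) (τ : ℍ) :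
    (f ∣[k] cosetRep p i) τ = ∑ l, r l τ * slashMatrix w b τ i l := by
  rw [← h, SlashAction.sum_slash, Finset.sum_apply]
  refine Finset.sum_congr rfl fun l _ ↦ ?_
  rw [mul_slash_of_mem_top (k₂ := w l) (by ring) (hr l) (b l)]
  rfl

lemma det_slashMatrix_ne_zero (hspan : ∀ k, ∀ f ∈ modFun (Gamma0 p) k,
      ∃ r : Option (ZMod p) → ℍ → ℂ, (∀ l, r l ∈ modFun ⊤ (k - w l)) ∧ ∑ l, r l * b l = f)
    (τ : ℍ) : (slashMatrix w b τ).det ≠ 0 := by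
  intro hdet
  obtain ⟨v, hv, hv0⟩ := Matrix.exists_vecMul_eq_zero_iff.2 hdet
  refine hv (eq_zero_of_forall_sum_eq_zero τ v fun k f hf ↦ ?_)
  obtain ⟨r, hr, h⟩ := hspan k f hf
  simp_rw [sum_mul_slash hr h, Finset.mul_sum, mul_left_comm (v _)]
  rw [Finset.sum_comm]
  refine Finset.sum_eq_zero fun l _ ↦ ?_
  rw [← Finset.mul_sum]
  have := congrFun hv0 l
  rw [Matrix.vecMul, dotProduct] at this
  rw [this, Pi.zero_apply, mul_zero]

/-- The matrix of values of the cusp forms dual to the basis `b` with respect to the trace. -/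
noncomputable def dualMatrix (w : Option (ZMod p) → ℤ) (b : Option (ZMod p) → ℍ → ℂ) (τ : ℍ) :
    Matrix (Option (ZMod p)) (Option (ZMod p)) ℂ :=
  Δ τ • (slashMatrix w b τ)⁻¹

lemma dualMatrix_slash (hb : ∀ l, b l ∈ modFun (Gamma0 p) (w l)) (l i : Option (ZMod p))
    (g : SL(2, ℤ)) : (fun τ ↦ dualMatrix w b τ l i) ∣[12 - w l] g =
      fun τ ↦ dualMatrix w b τ l (cosetPerm p g i) := by
  ext τ
  have hd : ∀ n : ℤ, denom g τ ^ n ≠ 0 := fun n ↦ zpow_ne_zero _ (denom_ne_zero _ τ)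
  have h := congrArg (·⁻¹) (slashMatrix_smul_mul_diagonal hb g τ)
  simp only [Matrix.mul_inv_rev] at h
  have hsub : ((slashMatrix w b τ).submatrix (cosetPerm p g) id)⁻¹ =
      (slashMatrix w b τ)⁻¹.submatrix id (cosetPerm p g) :=
    Matrix.inv_submatrix_equiv _ (cosetPerm p g) (Equiv.refl _)
  have hdiag : (Matrix.diagonal fun l ↦ denom g τ ^ (-w l))⁻¹ =
      Matrix.diagonal fun l ↦ denom g τ ^ (w l) := by
    refine Matrix.inv_eq_left_inv ?_
    rw [Matrix.diagonal_mul_diagonal]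
    simp_rw [← zpow_add₀ (denom_ne_zero _ τ), add_neg_cancel, zpow_zero]
    exact Matrix.diagonal_one
  rw [hsub, hdiag] at h
  have h' := congrFun (congrFun h l) i
  rw [Matrix.diagonal_mul, Matrix.submatrix_apply, id] at h'
  have hΔ := congrFun (discriminant_mem_cuspFun.2.1 g (Subgroup.mem_top g)) τ
  rw [SL_slash_apply] at hΔ ⊢
  simp only [dualMatrix, Matrix.smul_apply, smul_eq_mul]
  rw [← h', ← hΔ, show -(12 - w l) = -12 + w l by ring, zpow_add₀ (denom_ne_zero _ τ)]
  ring

lemma mdifferentiable_dualMatrix (hb : ∀ l, b l ∈ modFun (Gamma0 p) (w l))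
    (hdet : ∀ τ, (slashMatrix w b τ).det ≠ 0) (l i : Option (ZMod p)) :
    MDiff fun τ ↦ dualMatrix w b τ l i := by
  have hentry : ∀ i l, MDiff fun τ ↦ slashMatrix w b τ i l := fun i l ↦ (hb l).1.slash _ _
  have h1 : (fun τ ↦ dualMatrix w b τ l i) = (Δ : ℍ → ℂ) *
      ((fun τ ↦ ((slashMatrix w b τ).updateRow i
      (Pi.single l 1)).det) / fun τ ↦ (slashMatrix w b τ).det) := by
    ext τ
    simp only [dualMatrix, Matrix.smul_apply, smul_eq_mul, Pi.mul_apply, Pi.div_apply,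
      Matrix.inv_def, Ring.inverse_eq_inv', Matrix.adjugate_apply]
    ring
  rw [h1]
  refine discriminant_mem_cuspFun.1.mul (MDifferentiable.div (mdifferentiable_det fun j m ↦ ?_)
    (mdifferentiable_det hentry) hdet)
  by_cases h : j = i
  · subst h
    simp only [Matrix.updateRow_self]
    exact mdifferentiable_const
  · simp only [Matrix.updateRow_ne h]
    exact hentry j m

lemma dualMatrix_mul (hdet : ∀ τ, (slashMatrix w b τ).det ≠ 0) (τ : ℍ) :
    dualMatrix w b τ * slashMatrix w b τ = Δ τ • 1 := by
  rw [dualMatrix, Matrix.smul_mul, Matrix.nonsing_inv_mul _ (isUnit_iff_ne_zero.2 (hdet τ))]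

lemma mul_dualMatrix (hdet : ∀ τ, (slashMatrix w b τ).det ≠ 0) (τ : ℍ) :
    slashMatrix w b τ * dualMatrix w b τ = Δ τ • 1 := by
  rw [dualMatrix, Matrix.mul_smul, Matrix.mul_nonsing_inv _ (isUnit_iff_ne_zero.2 (hdet τ))]

lemma tendsto_dualMatrix (hspan : ∀ k, ∀ f ∈ modFun (Gamma0 p) k,
      ∃ r : Option (ZMod p) → ℍ → ℂ, (∀ l, r l ∈ modFun ⊤ (k - w l)) ∧ ∑ l, r l * b l = f)
    (l i : Option (ZMod p)) : Tendsto (fun τ ↦ dualMatrix w b τ l i) atImInfty (𝓝 0) := by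
  refine tendsto_zero_of_forall_modFun p (x := fun i τ ↦ dualMatrix w b τ l i)
    (fun k h hh ↦ ?_) i
  obtain ⟨r, hr, hrh⟩ := hspan k h hh
  refine ⟨r l, by simpa using (hr l).2.2 1, fun τ ↦ ?_⟩
  simp_rw [sum_mul_slash hr hrh, Finset.sum_mul]
  rw [Finset.sum_comm]
  have h1 : ∀ m, ∑ i, dualMatrix w b τ l i * slashMatrix w b τ i m =
      (Δ τ • (1 : Matrix (Option (ZMod p)) (Option (ZMod p)) ℂ)) l m := fun m ↦ by
    rw [← dualMatrix_mul (det_slashMatrix_ne_zero hspan), Matrix.mul_apply]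
  have h2 : ∀ m, ∑ i, r m τ * slashMatrix w b τ i m * dualMatrix w b τ l i =
      r m τ * (Δ τ • (1 : Matrix (Option (ZMod p)) (Option (ZMod p)) ℂ)) l m := fun m ↦ by
    rw [← h1, Finset.mul_sum]
    exact Finset.sum_congr rfl fun i _ ↦ by ring
  rw [Finset.sum_congr rfl fun m _ ↦ h2 m, Finset.sum_eq_single l]
  · simp [mul_comm]
  · intro m _ hm
    simp [Matrix.one_apply_ne hm.symm]
  · simp

/-- The cusp forms dual to the basis `b`. -/
noncomputable def dualFun (w : Option (ZMod p) → ℤ) (b : Option (ZMod p) → ℍ → ℂ)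
    (l : Option (ZMod p)) : ℍ → ℂ := fun τ ↦ dualMatrix w b τ l none

lemma dualFun_slash (hb : ∀ l, b l ∈ modFun (Gamma0 p) (w l)) (l : Option (ZMod p))
    (g : SL(2, ℤ)) : dualFun w b l ∣[12 - w l] g = fun τ ↦ dualMatrix w b τ l (cosetCls p g) := by
  have : cosetPerm p g none = cosetCls p g := by
    change cosetCls p (cosetRep p none * g) = _
    rw [cosetRep_none, one_mul]
  change (fun τ ↦ dualMatrix w b τ l none) ∣[12 - w l] g = _
  rw [dualMatrix_slash hb, this]

lemma dualFun_mem (hb : ∀ l, b l ∈ modFun (Gamma0 p) (w l))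
    (hspan : ∀ k, ∀ f ∈ modFun (Gamma0 p) k,
      ∃ r : Option (ZMod p) → ℍ → ℂ, (∀ l, r l ∈ modFun ⊤ (k - w l)) ∧ ∑ l, r l * b l = f)
    (l : Option (ZMod p)) : dualFun w b l ∈ cuspFun (Gamma0 p) (12 - w l) := by
  refine ⟨mdifferentiable_dualMatrix hb (det_slashMatrix_ne_zero hspan) l none, fun γ hγ ↦ ?_,
    fun γ ↦ ?_⟩
  · have : cosetCls p γ = none := by
      rw [← cosetCls_cosetRep (p := p) none, cosetCls_eq_iff, cosetRep_none]
      simpa using hγ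
    rw [dualFun_slash hb, this]
    rfl
  · rw [dualFun_slash hb]
    exact tendsto_dualMatrix hspan l _

lemma nonempty_modFun_Gamma0_equiv (hb : ∀ l, b l ∈ modFun (Gamma0 p) (w l))
    (hspan : ∀ k, ∀ f ∈ modFun (Gamma0 p) k,
      ∃ r : Option (ZMod p) → ℍ → ℂ, (∀ l, r l ∈ modFun ⊤ (k - w l)) ∧ ∑ l, r l * b l = f)
    (k : ℤ) : Nonempty (((l : Option (ZMod p)) → modFun ⊤ (k - w l)) ≃ₗ[ℂ]
      modFun (Gamma0 p) k) := by
  let φ : ((l : Option (ZMod p)) → modFun ⊤ (k - w l)) →ₗ[ℂ] modFun (Gamma0 p) k :=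
    { toFun := fun r ↦ ⟨∑ l, (r l : ℍ → ℂ) * b l, sum_mem fun l _ ↦ modFun_congr (by ring)
        (mul_mem_modFun (modFun_mono le_top (r l).2) (hb l))⟩
      map_add' := fun r s ↦ by ext1; simp [add_mul, Finset.sum_add_distrib]
      map_smul' := fun c r ↦ by ext1; simp [Finset.smul_sum] }
  have hφ : Function.Bijective φ := by
    refine ⟨(injective_iff_map_eq_zero φ).2 fun r hr ↦ ?_, fun f ↦ ?_⟩
    · have hr' : ∑ l, (r l : ℍ → ℂ) * b l = 0 := congrArg Subtype.val hr
      ext l τ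
      by_contra hne
      refine det_slashMatrix_ne_zero hspan τ (Matrix.exists_mulVec_eq_zero_iff.1
        ⟨fun l ↦ (r l : ℍ → ℂ) τ, fun h ↦ hne (congrFun h l), ?_⟩)
      ext i
      have := sum_mul_slash (fun l ↦ (r l).2) hr' i τ
      rw [SlashAction.zero_slash] at this
      exact (Finset.sum_congr rfl fun _ _ ↦ mul_comm _ _).trans this.symm
    · obtain ⟨r, hr, h⟩ := hspan k f f.2
      exact ⟨fun l ↦ ⟨r l, hr l⟩, Subtype.ext h⟩
  exact ⟨.ofBijective φ hφ⟩

lemma finrank_cuspFun_Gamma0 (hb : ∀ l, b l ∈ modFun (Gamma0 p) (w l))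
    (hspan : ∀ k, ∀ f ∈ modFun (Gamma0 p) k,
      ∃ r : Option (ZMod p) → ℍ → ℂ, (∀ l, r l ∈ modFun ⊤ (k - w l)) ∧ ∑ l, r l * b l = f)
    (k : ℤ) : Module.finrank ℂ (cuspFun (Gamma0 p) k) =
      ∑ l, Module.finrank ℂ (modFun ⊤ (k - 12 + w l)) := by
  have := finite_modFun_top
  have hdet := det_slashMatrix_ne_zero hspan
  have hg := dualFun_mem hb hspan
  let φ : ((l : Option (ZMod p)) → modFun ⊤ (k - 12 + w l)) →ₗ[ℂ] cuspFun (Gamma0 p) k :=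
    { toFun := fun r ↦ ⟨∑ l, (r l : ℍ → ℂ) * dualFun w b l, sum_mem fun l _ ↦ by
        have := mul_mem_cuspFun (modFun_mono le_top (r l).2) (hg l)
        rwa [show k - 12 + w l + (12 - w l) = k by ring] at this⟩
      map_add' := fun r s ↦ by ext1; simp [add_mul, Finset.sum_add_distrib]
      map_smul' := fun c r ↦ by ext1; simp [Finset.smul_sum] }
  have hφ : Function.Bijective φ := by
    refine ⟨(injective_iff_map_eq_zero φ).2 fun r hr ↦ ?_, fun f ↦ ?_⟩
    · have hr' : ∑ l, (r l : ℍ → ℂ) * dualFun w b l = 0 := congrArg Subtype.val hr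
      have hvec : ∀ τ i, ∑ l, (r l : ℍ → ℂ) τ * dualMatrix w b τ l i = 0 := by
        intro τ i
        have h1 := congrFun (congrArg (· ∣[k] cosetRep p i) hr') τ
        simp only [SlashAction.zero_slash, SlashAction.sum_slash, Finset.sum_apply] at h1
        rw [← h1.trans (Pi.zero_apply τ)]
        refine Finset.sum_congr rfl fun l _ ↦ ?_
        rw [mul_slash_of_mem_top (by ring) (r l).2 (dualFun w b l) (k₂ := 12 - w l),
          dualFun_slash hb, cosetCls_cosetRep]
        rfl
      ext l τ
      have h2 : Matrix.vecMul (fun l ↦ (r l : ℍ → ℂ) τ) (dualMatrix w b τ) = 0 :=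
        funext fun i ↦ hvec τ i
      have h3 := congrArg (Matrix.vecMul · (slashMatrix w b τ)) h2
      simp only [Matrix.vecMul_vecMul, dualMatrix_mul hdet, Matrix.zero_vecMul,
        Matrix.vecMul_smul, Matrix.vecMul_one] at h3
      exact (smul_eq_zero.1 (congrFun h3 l)).resolve_left (discriminant_ne_zero τ)
    · have hbf : ∀ l, b l * f ∈ cuspFun (Gamma0 p) (w l + k) := fun l ↦ mul_mem_cuspFun (hb l) f.2
      have htr := fun l ↦ div_discriminant_mem (trace_mem_cuspFun (hbf l))
      refine ⟨fun l ↦ ⟨_, modFun_congr (by ring) (htr l)⟩, Subtype.ext (funext fun τ ↦ ?_)⟩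
      simp only [φ, LinearMap.coe_mk, AddHom.coe_mk, Finset.sum_apply, Pi.mul_apply, mul_slash_SL2]
      have h1 : ∀ i, ∑ l, slashMatrix w b τ i l * dualMatrix w b τ l none =
          (Δ τ • (1 : Matrix (Option (ZMod p)) (Option (ZMod p)) ℂ)) i none := fun i ↦ by
        rw [← mul_dualMatrix hdet, Matrix.mul_apply]
      have hΔ := discriminant_ne_zero τ
      calc _ = ∑ l, ∑ i, ((f : ℍ → ℂ) ∣[k] cosetRep p i) τ / Δ τ *
            (slashMatrix w b τ i l * dualMatrix w b τ l none) := by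
            refine Finset.sum_congr rfl fun l _ ↦ ?_
            rw [Finset.sum_div, Finset.sum_mul]
            refine Finset.sum_congr rfl fun i _ ↦ ?_
            rw [dualFun, slashMatrix, Matrix.of_apply]
            ring
        _ = ∑ i, ((f : ℍ → ℂ) ∣[k] cosetRep p i) τ / Δ τ *
            (Δ τ • (1 : Matrix (Option (ZMod p)) (Option (ZMod p)) ℂ)) i none := by
            rw [Finset.sum_comm]
            simp_rw [← Finset.mul_sum, h1]
        _ = (f : ℍ → ℂ) τ := by
            rw [Finset.sum_eq_single none]
            · rw [cosetRep_none, SlashAction.slash_one]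
              simp [hΔ]
            · intro i _ hi
              simp [Matrix.one_apply_ne hi]
            · simp
  rw [← (LinearEquiv.ofBijective φ hφ).finrank_eq, Module.finrank_pi_fintype]

end Dual

section CuspValues

variable (p : ℕ) [hp : Fact p.Prime] {k : ℤ} {f : ℍ → ℂ}

lemma tendsto_slash_cosetRep_some {c : ℂ}
    (hc : Tendsto (f ∣[k] cosetRep p (some 0)) atImInfty (𝓝 c)) (j : ZMod p) :
    Tendsto (f ∣[k] cosetRep p (some j)) atImInfty (𝓝 c) := by
  have h0 : cosetRep p (some 0) = ModularGroup.S := by simp [cosetRep]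
  have hj : f ∣[k] cosetRep p (some j) =
      fun τ ↦ (f ∣[k] ModularGroup.S) (((j.val : ℤ) : ℝ) +ᵥ τ) := by
    ext τ
    rw [cosetRep, SlashAction.slash_mul, slash_T_zpow_apply]
  rw [h0] at hc
  rw [hj]
  refine hc.comp ?_
  rw [atImInfty, tendsto_comap_iff]
  simpa [Function.comp_def] using tendsto_comap

lemma mem_cuspFun_of_tendsto (hf : f ∈ modFun (Gamma0 p) k)
    (h₁ : Tendsto (f ∣[k] cosetRep p none) atImInfty (𝓝 0))
    (h₂ : Tendsto (f ∣[k] cosetRep p (some 0)) atImInfty (𝓝 0)) : f ∈ cuspFun (Gamma0 p) k := by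
  refine ⟨hf.1, hf.2.1, fun γ ↦ ?_⟩
  rw [slash_eq_cosetRep hf.2.1]
  obtain h | ⟨j, h⟩ := (cosetCls p γ).eq_none_or_eq_some
  · rw [h]
    exact h₁
  · rw [h]
    exact tendsto_slash_cosetRep_some p h₂ j

/-- The value at the cusp given by a coset representative. -/
noncomputable def cuspValue (k : ℤ) (i : Option (ZMod p)) : modFun (Gamma0 p) k →ₗ[ℂ] ℂ where
  toFun f := (exists_tendsto_slash f.2 (cosetRep p i)).choose
  map_add' f g := by
    have hf := (exists_tendsto_slash f.2 (cosetRep p i)).choose_spec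
    have hg := (exists_tendsto_slash g.2 (cosetRep p i)).choose_spec
    have h := (exists_tendsto_slash (f + g).2 (cosetRep p i)).choose_spec
    refine tendsto_nhds_unique h ?_
    rw [Submodule.coe_add, SlashAction.add_slash]
    exact hf.add hg
  map_smul' c f := by
    have hf := (exists_tendsto_slash f.2 (cosetRep p i)).choose_spec
    have h := (exists_tendsto_slash (c • f).2 (cosetRep p i)).choose_spec
    refine tendsto_nhds_unique h ?_
    rw [Submodule.coe_smul, ModularForm.SL_smul_slash]
    exact hf.const_smul c

lemma tendsto_cuspValue (f : modFun (Gamma0 p) k) (i : Option (ZMod p)) :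
    Tendsto ((f : ℍ → ℂ) ∣[k] cosetRep p i) atImInfty (𝓝 (cuspValue p k i f)) :=
  (exists_tendsto_slash f.2 (cosetRep p i)).choose_spec

lemma finrank_modFun_Gamma0_four [FiniteDimensional ℂ (modFun (Gamma0 p) 4)] :
    Module.finrank ℂ (modFun (Gamma0 p) 4) = Module.finrank ℂ (cuspFun (Gamma0 p) 4) + 2 := by
  let φ : modFun (Gamma0 p) 4 →ₗ[ℂ] ℂ × ℂ := (cuspValue p 4 none).prod (cuspValue p 4 (some 0))
  have hker : φ.ker = (cuspFun (Gamma0 p) 4).comap (modFun (Gamma0 p) 4).subtype := by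
    ext f
    rw [LinearMap.mem_ker, Prod.ext_iff]
    change cuspValue p 4 none f = 0 ∧ cuspValue p 4 (some 0) f = 0 ↔ (f : ℍ → ℂ) ∈ cuspFun _ 4
    refine ⟨fun h ↦ mem_cuspFun_of_tendsto p f.2 ?_ ?_, fun h ↦ ⟨?_, ?_⟩⟩
    · simpa [h.1] using tendsto_cuspValue p f none
    · simpa [h.2] using tendsto_cuspValue p f (some 0)
    · exact tendsto_nhds_unique (tendsto_cuspValue p f _) (h.2.2 _)
    · exact tendsto_nhds_unique (tendsto_cuspValue p f _) (h.2.2 _)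
  have hp0 : (p : ℂ) ≠ 0 := by exact_mod_cast hp.out.ne_zero
  have hsurj : Function.Surjective φ := by
    have hinv := fun γ ↦ E_four_mem.2.1 γ (Subgroup.mem_top γ)
    let e : modFun (Gamma0 p) 4 := ⟨_, modFun_mono le_top E_four_mem⟩
    let e' : modFun (Gamma0 p) 4 := ⟨_, levelRaise_mem p E_four_mem⟩
    have he : φ e = (1, 1) := Prod.ext
      (tendsto_nhds_unique (tendsto_cuspValue p e _) (by simpa only [e, hinv] using tendsto_E_four))
      (tendsto_nhds_unique (tendsto_cuspValue p e _) (by simpa only [e, hinv] using tendsto_E_four))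
    have he' : φ e' = ((p : ℂ) ^ 3, (p : ℂ)⁻¹) := Prod.ext
      (tendsto_nhds_unique (tendsto_cuspValue p e' _)
        (by simpa using tendsto_levelRaise_slash_none p (k := 4) tendsto_E_four))
      (tendsto_nhds_unique (tendsto_cuspValue p e' _)
        (by simpa using tendsto_levelRaise_slash_some p hinv tendsto_E_four 0))
    have hd : (p : ℂ) ^ 3 - (p : ℂ)⁻¹ ≠ 0 := by
      intro h
      have h4 : (p : ℂ) ^ 4 = 1 := by
        field_simp at h
        linear_combination h
      have h4' : p ^ 4 = 1 := by exact_mod_cast h4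
      exact hp.out.one_lt.ne' ((Nat.pow_eq_one.1 h4').resolve_right (by norm_num))
    rintro ⟨x, y⟩
    refine ⟨((p ^ 3 * y - (p : ℂ)⁻¹ * x) / ((p : ℂ) ^ 3 - (p : ℂ)⁻¹)) • e +
      ((x - y) / ((p : ℂ) ^ 3 - (p : ℂ)⁻¹)) • e', ?_⟩
    rw [map_add, map_smul, map_smul, he, he']
    ext
    · simp only [Prod.smul_mk, Prod.mk_add_mk, smul_eq_mul]
      rw [mul_one, div_mul_eq_mul_div, ← add_div, div_eq_iff hd]
      ring
    · simp only [Prod.smul_mk, Prod.mk_add_mk, smul_eq_mul]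
      rw [mul_one, div_mul_eq_mul_div, ← add_div, div_eq_iff hd]
      ring
  have h := φ.finrank_range_add_finrank_ker
  rw [LinearMap.range_eq_top.2 hsurj, finrank_top, hker,
    (Submodule.comapSubtypeEquivOfLe cuspFun_le_modFun).finrank_eq] at h
  simp at h
  omega

end CuspValues

section Elliptic

variable {p : ℕ} [hp : Fact p.Prime] {w : Option (ZMod p) → ℤ} {b : Option (ZMod p) → ℍ → ℂ}

lemma sum_denom_zpow (hb : ∀ l, b l ∈ modFun (Gamma0 p) (w l)) {g : SL(2, ℤ)} {τ : ℍ}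
    (hdet : (slashMatrix w b τ).det ≠ 0) (hg : g • τ = τ) :
    ∑ l, denom g τ ^ (-w l) = ((Finset.univ.filter fun i ↦ cosetPerm p g i = i).card : ℂ) := by
  have h := slashMatrix_smul_mul_diagonal hb g τ
  have hsub : (slashMatrix w b τ).submatrix (cosetPerm p g) id =
      (cosetPerm p g).permMatrix ℂ * slashMatrix w b τ := by
    ext i l
    simp [Matrix.mul_apply, Equiv.Perm.permMatrix, PEquiv.toMatrix_apply, Equiv.toPEquiv_apply]
  rw [hg, hsub] at h
  have h2 := congrArg (fun N ↦ Matrix.trace ((slashMatrix w b τ)⁻¹ * N)) h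
  have hu := isUnit_iff_ne_zero.2 hdet
  rw [← Matrix.mul_assoc, Matrix.nonsing_inv_mul _ hu, one_mul, Matrix.trace_mul_comm,
    Matrix.mul_assoc, Matrix.mul_nonsing_inv _ hu, mul_one, Matrix.trace_diagonal] at h2
  rw [h2, Matrix.trace]
  simp [Equiv.Perm.permMatrix, Equiv.toPEquiv_apply]

lemma card_fixedPoints_cosetPerm (g : SL(2, ℤ)) (hg : (g 1 0 : ZMod p) ≠ 0) :
    (Finset.univ.filter fun i ↦ cosetPerm p g i = i).card =
      (Finset.univ.filter fun j : ZMod p ↦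
        (g 0 0 + j * g 1 0 : ZMod p) * j = g 0 1 + j * g 1 1).card := by
  have hnone : cosetPerm p g none ≠ none := by
    change cosetCls p (cosetRep p none * g) ≠ none
    simp [cosetCls, cosetRep_none, hg]
  have hsome : ∀ j : ZMod p, cosetPerm p g (some j) = some j ↔
      (g 0 0 + j * g 1 0 : ZMod p) * j = g 0 1 + j * g 1 1 := by
    intro j
    change cosetCls p (cosetRep p (some j) * g) = some j ↔ _
    have : cosetCls p (cosetRep p (some j) * g) = some j ↔
        cosetCls p (cosetRep p (some j) * g) = cosetCls p (cosetRep p (some j)) := by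
      rw [cosetCls_cosetRep]
    rw [this, cosetCls_eq_iff_cross, Matrix.SpecialLinearGroup.coe_mul, cosetRep_some_apply]
    simp [Matrix.mul_apply, Fin.sum_univ_two]
  have : (Finset.univ.filter fun i ↦ cosetPerm p g i = i) = (Finset.univ.filter fun j : ZMod p ↦
      (g 0 0 + j * g 1 0 : ZMod p) * j = g 0 1 + j * g 1 1).map Function.Embedding.some := by
    ext i
    cases i with
    | none => simpa using hnone
    | some j => simp [hsome]
  rw [this, Finset.card_map]

lemma card_fixedPoints_S : (Finset.univ.filter fun i ↦ cosetPerm p ModularGroup.S i = i).card =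
    (Finset.univ.filter fun j : ZMod p ↦ j ^ 2 + 1 = 0).card := by
  rw [card_fixedPoints_cosetPerm _ (by simp [ModularGroup.S])]
  congr 1
  ext j
  simp only [Finset.mem_filter, Finset.mem_univ, true_and]
  simp [ModularGroup.S]
  constructor <;> intro h <;> linear_combination h

lemma card_fixedPoints_TS :
    (Finset.univ.filter fun i ↦ cosetPerm p (ModularGroup.T * ModularGroup.S) i = i).card =
      (Finset.univ.filter fun j : ZMod p ↦ j ^ 2 + j + 1 = 0).card := by
  rw [card_fixedPoints_cosetPerm _ (by simp)]
  congr 1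
  ext j
  simp only [Finset.mem_filter, Finset.mem_univ, true_and]
  simp
  constructor <;> intro h <;> linear_combination h

lemma S_smul_I : ModularGroup.S • UpperHalfPlane.I = UpperHalfPlane.I := by
  apply UpperHalfPlane.ext
  rw [modular_S_smul]
  simp

/-- The sixth root of unity in the upper half plane. -/
noncomputable def sixthRoot : ℍ := ⟨⟨1 / 2, √3 / 2⟩, by simp⟩

lemma sixthRoot_sq : (sixthRoot : ℂ) ^ 2 = sixthRoot - 1 := by
  have h := Real.mul_self_sqrt (show (0 : ℝ) ≤ 3 by norm_num)
  apply Complex.ext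
  · simp [sixthRoot, pow_two]
    linear_combination -h / 4
  · simp [sixthRoot, pow_two]
    ring

lemma TS_smul_sixthRoot :
    (ModularGroup.T * ModularGroup.S) • sixthRoot = sixthRoot := by
  apply UpperHalfPlane.ext
  rw [mul_smul, modular_T_smul, modular_S_smul]
  simp only [coe_vadd]
  have h := sixthRoot_sq
  have h0 : (sixthRoot : ℂ) ≠ 0 := sixthRoot.ne_zero
  have h0' : (-(sixthRoot : ℂ)) ≠ 0 := neg_ne_zero.2 h0
  change ((1 : ℝ) : ℂ) + (-(sixthRoot : ℂ))⁻¹ = sixthRoot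
  push_cast
  field_simp
  linear_combination -h

lemma denom_TS (τ : ℍ) : denom (ModularGroup.T * ModularGroup.S : SL(2, ℤ)) τ = τ := by
  rw [ModularGroup.denom_apply]
  simp

end Elliptic

section Weights

variable {p : ℕ} [hp : Fact p.Prime] {w : Option (ZMod p) → ℤ} {b : Option (ZMod p) → ℍ → ℂ}

lemma finrank_modFun_top_two_mul {n : ℤ} (hn : 0 ≤ n) :
    (Module.finrank ℂ (modFun ⊤ (2 * n)) : ℤ) = if n % 6 = 1 then n / 6 else n / 6 + 1 := by
  lift n to ℕ using hn
  rw [show (2 * n : ℤ) = ((2 * n : ℕ) : ℤ) by push_cast; rfl, finrank_modFun_top _ ⟨n, by ring⟩]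
  have : 2 * n ≡ 2 [MOD 12] ↔ n % 6 = 1 := by
    rw [Nat.ModEq]
    omega
  simp only [this]
  split_ifs <;> omega

lemma finrank_modFun_top_of_neg {k : ℤ} (hk : k < 0) : Module.finrank ℂ (modFun ⊤ k) = 0 := by
  have : modFun ⊤ k = ⊥ := (Submodule.eq_bot_iff _).2 fun f hf ↦ eq_zero_of_neg hk hf
  rw [this, finrank_bot]

lemma finrank_modFun_top_zero : Module.finrank ℂ (modFun ⊤ 0) = 1 := by
  simpa [Nat.ModEq] using finrank_modFun_top 0 ⟨0, rfl⟩

lemma finrank_modFun_Gamma0_zero : Module.finrank ℂ (modFun (Gamma0 p) 0) = 1 := by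
  rw [finrank_eq_one_iff']
  refine ⟨⟨_, const_mem_modFun 1⟩, fun h ↦ ?_, fun f ↦ ?_⟩
  · have := congrFun (congrArg Subtype.val h) UpperHalfPlane.I
    simp at this
  · obtain ⟨c, hc⟩ := eq_const_of_weight_zero f.2
    refine ⟨c, Subtype.ext ?_⟩
    rw [hc]
    ext
    simp

lemma exists_weight_eq (hb : ∀ l, b l ∈ modFun (Gamma0 p) (w l))
    (hspan : ∀ k, ∀ f ∈ modFun (Gamma0 p) k,
      ∃ r : Option (ZMod p) → ℍ → ℂ, (∀ l, r l ∈ modFun ⊤ (k - w l)) ∧ ∑ l, r l * b l = f)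
    (l : Option (ZMod p)) : ∃ j : Fin 6, w l = 2 * (j : ℕ) := by
  have hdet := det_slashMatrix_ne_zero hspan UpperHalfPlane.I
  have hb0 : b l ≠ 0 := fun h ↦ hdet <| Matrix.det_eq_zero_of_column_eq_zero l fun i ↦ by
    simp [slashMatrix, h]
  have hd0 : dualFun w b l ≠ 0 := fun h ↦ by
    have h1 := congrFun (congrFun (dualMatrix_mul (det_slashMatrix_ne_zero hspan)
      UpperHalfPlane.I) l) l
    have h2 : ∀ i, dualMatrix w b UpperHalfPlane.I l i = 0 := fun i ↦ by
      have := congrFun (dualFun_slash hb l (cosetRep p i)) UpperHalfPlane.I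
      rw [h, SlashAction.zero_slash, cosetCls_cosetRep] at this
      exact this.symm
    simp only [Matrix.mul_apply, h2, zero_mul, Finset.sum_const_zero, Matrix.smul_apply,
      Matrix.one_apply_eq, smul_eq_mul, mul_one] at h1
    exact discriminant_ne_zero _ h1.symm
  have hneg : (-1 : SL(2, ℤ)) ∈ Gamma0 p := by simp [Gamma0_mem]
  have h0 : 0 ≤ w l := by
    by_contra! h
    exact hb0 (eq_zero_of_neg h (hb l))
  have h12 : w l < 12 := by
    by_contra! h
    have hm := dualFun_mem hb hspan l
    obtain h | h := h.eq_or_lt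
    · rw [← h, sub_self] at hm
      exact hd0 (eq_zero_of_cuspFun_zero hm)
    · exact hd0 (eq_zero_of_neg (by lia) (cuspFun_le_modFun hm))
  obtain ⟨n, hn⟩ : Even (w l) := by
    rw [← Int.not_odd_iff_even]
    exact fun h ↦ hb0 (eq_zero_of_odd hneg h (hb l))
  exact ⟨⟨n.toNat, by omega⟩, by simp; omega⟩

lemma exists_weight_count (p : ℕ) [hp : Fact p.Prime] : ∃ a : Fin 6 → ℕ,
    a 0 + a 1 + a 2 + a 3 + a 4 + a 5 = p + 1 ∧ a 0 = 1 ∧ a 2 = a 4 + 1 ∧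
    a 0 + a 2 + a 4 = a 1 + a 3 + a 5 + (Finset.univ.filter fun j : ZMod p ↦ j ^ 2 + 1 = 0).card ∧
    a 1 + a 4 = a 2 + a 5 ∧
    a 0 + a 3 = a 2 + a 5 + (Finset.univ.filter fun j : ZMod p ↦ j ^ 2 + j + 1 = 0).card ∧
    ∀ k, Module.finrank ℂ (cuspFun (Gamma0 p) k) =
      a 0 * Module.finrank ℂ (modFun ⊤ (k - 12 + 0)) +
      a 1 * Module.finrank ℂ (modFun ⊤ (k - 12 + 2)) +
      a 2 * Module.finrank ℂ (modFun ⊤ (k - 12 + 4)) +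
      a 3 * Module.finrank ℂ (modFun ⊤ (k - 12 + 6)) +
      a 4 * Module.finrank ℂ (modFun ⊤ (k - 12 + 8)) +
      a 5 * Module.finrank ℂ (modFun ⊤ (k - 12 + 10)) := by
  obtain ⟨w, b, hb, hspan, -⟩ := exists_basis_Gamma0 p
  choose v hv using exists_weight_eq hb hspan
  let a : Fin 6 → ℕ := fun j ↦ (Finset.univ.filter fun l ↦ v l = j).card
  have hsum {M : Type} [AddCommMonoid M] (F : ℤ → M) :
      ∑ l, F (w l) = a 0 • F 0 + a 1 • F 2 + a 2 • F 4 + a 3 • F 6 + a 4 • F 8 + a 5 • F 10 := by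
    refine .trans ?_ (Fin.sum_univ_six fun j ↦ a j • F (2 * (j : ℕ)))
    rw [← Finset.sum_fiberwise Finset.univ v]
    refine Finset.sum_congr rfl fun j _ ↦ Finset.sum_eq_card_nsmul fun l hl ↦ ?_
    rw [hv, (Finset.mem_filter.1 hl).2]
  have hfin := finite_modFun_top
  obtain ⟨D, hD⟩ : ∃ D : ℤ → ℕ, ∀ n, Module.finrank ℂ (modFun ⊤ n) = D n := ⟨_, fun _ ↦ rfl⟩
  have hM (k : ℤ) : Module.finrank ℂ (modFun (Gamma0 p) k) = ∑ l, D (k - w l) := by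
    obtain ⟨e⟩ := nonempty_modFun_Gamma0_equiv hb hspan k
    rw [← e.finrank_eq, Module.finrank_pi_fintype]
    simp_rw [hD]
  have hS (k : ℤ) : Module.finrank ℂ (cuspFun (Gamma0 p) k) = ∑ l, D (k - 12 + w l) := by
    rw [finrank_cuspFun_Gamma0 hb hspan]
    simp_rw [hD]
  have hDneg : ∀ n : ℤ, n < 0 → D n = 0 := fun n hn ↦
    (hD n).symm.trans (finrank_modFun_top_of_neg hn)
  have hD0 : D 0 = 1 := (hD 0).symm.trans finrank_modFun_top_zero
  have hD2 : D 2 = 0 := (hD 2).symm.trans <| by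
    simpa [Nat.ModEq] using finrank_modFun_top 2 ⟨1, rfl⟩
  have hD4 : D 4 = 1 := (hD 4).symm.trans <| by
    simpa [Nat.ModEq] using finrank_modFun_top 4 ⟨2, rfl⟩
  have h0 : a 0 = 1 := by
    have := hM 0
    rw [finrank_modFun_Gamma0_zero, hsum fun n ↦ D (0 - n)] at this
    simpa [hDneg, hD0] using this.symm
  have h4 : a 2 = a 4 + 1 := by
    obtain ⟨e⟩ := nonempty_modFun_Gamma0_equiv hb hspan 4
    have := e.finiteDimensional
    have h := finrank_modFun_Gamma0_four p
    rw [hM, hS, hsum fun n ↦ D (4 - n), hsum fun n ↦ D (4 - 12 + n)] at h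
    norm_num [hDneg, hD0, hD2, hD4] at h
    omega
  have hcard : a 0 + a 1 + a 2 + a 3 + a 4 + a 5 = p + 1 := by
    have := hsum fun _ ↦ 1
    simpa [ZMod.card] using this.symm
  have h2 := sum_denom_zpow hb (det_slashMatrix_ne_zero hspan _) S_smul_I
  rw [card_fixedPoints_S, ModularGroup.denom_S, hsum fun n ↦ (UpperHalfPlane.I : ℂ) ^ (-n)] at h2
  have h3 := sum_denom_zpow hb (det_slashMatrix_ne_zero hspan _) TS_smul_sixthRoot
  rw [card_fixedPoints_TS, denom_TS, hsum fun n ↦ (sixthRoot : ℂ) ^ (-n)] at h3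
  have h3' : ((a 0 + a 3 : ℂ) - (a 2 + a 5)) + (a 2 + a 5 - (a 1 + a 4)) * (sixthRoot : ℂ) =
      (Finset.univ.filter fun j : ZMod p ↦ j ^ 2 + j + 1 = 0).card := by
    have hr := sixthRoot_sq
    have hn (n : ℕ) : (sixthRoot : ℂ) ^ (-(2 * n : ℤ)) = (-sixthRoot) ^ n := by
      have hr2 : ((sixthRoot : ℂ) ^ 2)⁻¹ = -sixthRoot :=
        inv_eq_of_mul_eq_one_right (by linear_combination (-1 - (sixthRoot : ℂ)) * hr)
      rw [← hr2, inv_pow, ← pow_mul, zpow_neg]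
      norm_cast
    have e2 := hn 1
    have e4 := hn 2
    have e6 := hn 3
    have e8 := hn 4
    have e10 := hn 5
    norm_num only at e2 e4 e6 e8 e10 h3
    rw [e2, e4, e6, e8, e10] at h3
    rw [← h3]
    simp only [nsmul_eq_mul, zpow_zero]
    linear_combination -(a 2 - a 3 * (sixthRoot + 1) + a 4 * sixthRoot * (sixthRoot + 1) +
      a 5 * (1 - sixthRoot ^ 2 * (sixthRoot + 1))) * hr
  have him := congrArg Complex.im h3'
  have h5 : a 1 + a 4 = a 2 + a 5 := by
    simp [sixthRoot] at him
    have : (a 1 + a 4 : ℝ) = a 2 + a 5 := by linarith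
    exact_mod_cast this
  have h5' : (a 1 + a 4 : ℂ) = a 2 + a 5 := by exact_mod_cast h5
  refine ⟨a, hcard, h0, h4, ?_, h5, ?_, fun k ↦ ?_⟩
  · have hI : ∀ n : ℕ, (UpperHalfPlane.I : ℂ) ^ (-(2 * n : ℤ)) = (-1) ^ n := fun n ↦ by
      rw [UpperHalfPlane.coe_I, zpow_neg, zpow_mul]
      norm_num [← inv_pow]
    have e2 := hI 1
    have e4 := hI 2
    have e6 := hI 3
    have e8 := hI 4
    have e10 := hI 5
    norm_num only at e2 e4 e6 e8 e10 h2
    rw [e2, e4, e6, e8, e10] at h2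
    simp only [nsmul_eq_mul, zpow_zero] at h2
    have : ((a 0 + a 2 + a 4 : ℕ) : ℂ) = (a 1 + a 3 + a 5 +
      (Finset.univ.filter fun j : ZMod p ↦ j ^ 2 + 1 = 0).card : ℕ) := by
      push_cast
      linear_combination h2
    exact_mod_cast this
  · rw [h5', sub_self, zero_mul, add_zero, sub_eq_iff_eq_add'] at h3'
    exact_mod_cast h3'
  · simp_rw [hS, hD]
    exact hsum fun n ↦ D (k - 12 + n)

end Weights

section RootCounts

lemma sq_add_self_add_one_eq_zero_iff_three : ∀ j : ZMod 3, j ^ 2 + j + 1 = 0 ↔ j = 1 := by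
  decide

lemma card_sq_add_self_add_one_eq_zero_three [Fact (Nat.Prime 3)] :
    (Finset.univ.filter fun j : ZMod 3 ↦ j ^ 2 + j + 1 = 0).card = 1 := by
  rw [Finset.card_eq_one]
  exact ⟨1, by ext j; simp [sq_add_self_add_one_eq_zero_iff_three]⟩

variable (p : ℕ) [hp : Fact p.Prime]

lemma two_ne_zero_of_odd (hodd : Odd p) : (2 : ZMod p) ≠ 0 := by
  intro h
  have : ((2 : ℕ) : ZMod p) = 0 := by exact_mod_cast h
  rw [ZMod.natCast_eq_zero_iff] at this
  obtain rfl := (Nat.prime_dvd_prime_iff_eq hp.out Nat.prime_two).1 this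
  exact absurd hodd (by decide)

lemma card_sq_add_one_eq_zero (hodd : Odd p) :
    (Finset.univ.filter fun j : ZMod p ↦ j ^ 2 + 1 = 0).card = if p % 4 = 1 then 2 else 0 := by
  have h2 := two_ne_zero_of_odd p hodd
  rw [Nat.odd_iff] at hodd
  split_ifs with h
  · obtain ⟨x, hx⟩ := ZMod.exists_sq_eq_neg_one_iff.2 (show p % 4 ≠ 3 by omega)
    rw [Finset.card_eq_two]
    refine ⟨x, -x, fun h ↦ ?_, ?_⟩
    · have hx0 : x = 0 := (mul_eq_zero.1 (show 2 * x = 0 by linear_combination h)).resolve_left h2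
      simp [hx0] at hx
    · ext y
      have : y ^ 2 + 1 = (y - x) * (y - -x) := by linear_combination -hx
      simp only [Finset.mem_filter, Finset.mem_univ, true_and, Finset.mem_insert,
        Finset.mem_singleton, this, mul_eq_zero, sub_eq_zero]
  · rw [Finset.card_eq_zero, Finset.filter_eq_empty_iff]
    intro x _ hx
    exact ZMod.exists_sq_eq_neg_one_iff.1 ⟨x, by linear_combination -hx⟩ (by omega)

lemma card_sq_add_self_add_one_eq_zero (hp3 : p ≠ 3) :
    (Finset.univ.filter fun j : ZMod p ↦ j ^ 2 + j + 1 = 0).card =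
      if p % 3 = 1 then 2 else 0 := by
  have h3 : (3 : ZMod p) ≠ 0 := by
    intro h
    have : ((3 : ℕ) : ZMod p) = 0 := by exact_mod_cast h
    rw [ZMod.natCast_eq_zero_iff] at this
    exact hp3 ((Nat.prime_dvd_prime_iff_eq hp.out Nat.prime_three).1 this)
  have hcard : Fintype.card (ZMod p)ˣ = p - 1 := ZMod.card_units p
  have hpos := hp.out.pos
  split_ifs with h
  · have : Fact (Nat.Prime 3) := ⟨Nat.prime_three⟩
    obtain ⟨u, hu⟩ := exists_prime_orderOf_dvd_card 3 (G := (ZMod p)ˣ) (by rw [hcard]; omega)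
    have hu3 : (u : ZMod p) ^ 3 = 1 := by
      rw [← hu, ← Units.val_pow_eq_pow_val, pow_orderOf_eq_one, Units.val_one]
    have hu1 : (u : ZMod p) - 1 ≠ 0 := by
      intro h
      have : u = 1 := Units.ext (by simpa using sub_eq_zero.1 h)
      simp [this] at hu
    have hx : (u : ZMod p) ^ 2 + u + 1 = 0 :=
      (mul_eq_zero.1 (show ((u : ZMod p) - 1) * _ = 0 by linear_combination hu3)).resolve_left hu1
    rw [Finset.card_eq_two]
    refine ⟨u, -1 - u, fun h ↦ h3 ?_, ?_⟩
    · linear_combination 4 * hx - (2 * (u : ZMod p) + 1) * h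
    · ext y
      have : y ^ 2 + y + 1 = (y - u) * (y - (-1 - u)) := by linear_combination hx
      simp only [Finset.mem_filter, Finset.mem_univ, true_and, Finset.mem_insert,
        Finset.mem_singleton, this, mul_eq_zero, sub_eq_zero]
  · rw [Finset.card_eq_zero, Finset.filter_eq_empty_iff]
    intro x _ hx
    have hx3 : x ^ 3 = 1 := by linear_combination (x - 1) * hx
    have hx1 : x ≠ 1 := by
      rintro rfl
      exact h3 (by linear_combination hx)
    have : Fact (Nat.Prime 3) := ⟨Nat.prime_three⟩
    have hdvd := ZMod.orderOf_dvd_card_sub_one (p := p) (a := x) (by rintro rfl; simp at hx)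
    rw [orderOf_eq_prime hx3 hx1] at hdvd
    have : p % 3 ≠ 0 := fun h ↦ hp3
      ((Nat.prime_dvd_prime_iff_eq Nat.prime_three hp.out).1 (Nat.dvd_of_mod_eq_zero h)).symm
    omega

end RootCounts

section DimensionFormula

/-- The dimension formula for modular forms of level one and weight `2 * n`. -/
def dimFormula (n : ℤ) : ℤ := if n % 6 = 1 then n / 6 else n / 6 + 1

lemma dimFormula_six_mul_add (x n : ℤ) : dimFormula (6 * x + n) = x + dimFormula n := by
  simp only [dimFormula]
  split_ifs <;> omega

lemma finrank_modFun_top_eq_dimFormula {n : ℤ} (hn : -5 < n) :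
    (Module.finrank ℂ (modFun ⊤ (2 * n)) : ℤ) = dimFormula n := by
  obtain h | h := lt_or_ge n 0
  · rw [finrank_modFun_top_of_neg (by omega), dimFormula]
    split_ifs <;> omega
  · exact finrank_modFun_top_two_mul h

lemma sum_mul_dimFormula {a₀ a₁ a₂ a₃ a₄ a₅ e₂ e₃ h m : ℤ}
    (hsum : a₀ + a₁ + a₂ + a₃ + a₄ + a₅ = 2 * h + 2) (h₀ : a₀ = 1) (h₂ : a₂ = a₄ + 1)
    (hi : a₀ + a₂ + a₄ = a₁ + a₃ + a₅ + e₂) (hr : a₁ + a₄ = a₂ + a₅) (hr' : a₀ + a₃ = a₂ + a₅ + e₃)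
    (he : h = 1 ∧ e₂ = 0 ∧ e₃ = 1 ∨ h % 6 = 0 ∧ e₂ = 2 ∧ e₃ = 2 ∨ h % 6 = 2 ∧ e₂ = 2 ∧ e₃ = 0 ∨
      h % 6 = 3 ∧ e₂ = 0 ∧ e₃ = 2 ∨ h % 6 = 5 ∧ e₂ = 0 ∧ e₃ = 0) :
    a₀ * dimFormula (m - 6) + a₁ * dimFormula (m - 5) + a₂ * dimFormula (m - 4) +
        a₃ * dimFormula (m - 3) + a₄ * dimFormula (m - 2) + a₅ * dimFormula (m - 1) =
      dimFormula (m * (h + 1) - 6) + dimFormula (m * (h + 1) - h - 6) := by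
  obtain ⟨t, s, hs, hs', rfl⟩ : ∃ t s : ℤ, 0 ≤ s ∧ s < 6 ∧ m = 6 * t + s :=
    ⟨m / 6, m % 6, by omega, by omega, by omega⟩
  obtain ⟨q, r, hq, hr0, hr6⟩ : ∃ q r : ℤ, h = 6 * q + r ∧ 0 ≤ r ∧ r < 6 :=
    ⟨h / 6, h % 6, by omega, by omega, by omega⟩
  have e₁ : (6 * t + s) * (h + 1) - 6 = 6 * (t * (h + 1) + s * q) + (s * (r + 1) - 6) := by
    rw [hq]; ring
  have e₂ : (6 * t + s) * (h + 1) - h - 6 =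
      6 * (t * (h + 1) + s * q - q) + (s * (r + 1) - r - 6) := by
    rw [hq]; ring
  rw [e₁, e₂]
  simp only [add_sub_assoc, dimFormula_six_mul_add]
  suffices H : a₀ * dimFormula (s - 6) + a₁ * dimFormula (s - 5) + a₂ * dimFormula (s - 4) +
      a₃ * dimFormula (s - 3) + a₄ * dimFormula (s - 2) + a₅ * dimFormula (s - 1) =
      2 * (s * q) - q + dimFormula (s * (r + 1) - 6) + dimFormula (s * (r + 1) - r - 6) by
    linear_combination H + t * hsum
  have hcases : r = 0 ∨ r = 1 ∨ r = 2 ∨ r = 3 ∨ r = 5 := by omega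
  interval_cases s <;> obtain rfl | rfl | rfl | rfl | rfl := hcases <;>
    norm_num [dimFormula] <;> omega

end DimensionFormula

lemma Gamma0_one_eq_top : Gamma0 1 = ⊤ := by
  refine eq_top_iff.2 fun γ _ ↦ ?_
  rw [Gamma0_mem]
  exact Subsingleton.elim _ _

lemma finrank_cuspForm_Gamma0_one (k : ℤ) :
    Module.finrank ℂ (CuspForm (Gamma0 1) k) = Module.finrank ℂ (modFun ⊤ (k - 12)) := by
  rw [← (cuspFunEquiv (Gamma0 1) k).finrank_eq, Gamma0_one_eq_top, finrank_cuspFun_top]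

end LevelOneAndPrimeLevel

/-- Let `p` be an odd prime and `k = 2 m` an even integer with `k ≥ 4`.  Then
`dim S_k(Γ₀(p)) = dim S_{m(p+1)}(SL₂(ℤ)) + dim S_{m(p+1)-(p-1)}(SL₂(ℤ))`,
where `S_k(Γ)` denotes holomorphic cusp forms of weight `k` for `Γ`, and level one is
realised as `Γ₀(1) = SL₂(ℤ)`. -/
theorem finrank_cuspForm_prime_level_eq_sum
    (p : ℕ) (hp : p.Prime) (hodd : Odd p) (k m : ℤ) (hk : k = 2 * m) (hk4 : 4 ≤ k) :
    Module.finrank ℂ (CuspForm (Gamma0 p) k) =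
      Module.finrank ℂ (CuspForm (Gamma0 1) (m * (p + 1))) +
        Module.finrank ℂ (CuspForm (Gamma0 1) (m * (p + 1) - (p - 1))) := by
  have : Fact p.Prime := ⟨hp⟩
  obtain ⟨a, hsum, h0, h2, hi, hr, hr', hS⟩ := exists_weight_count p
  rw [← (cuspFunEquiv (Gamma0 p) k).finrank_eq, finrank_cuspForm_Gamma0_one,
    finrank_cuspForm_Gamma0_one, hS, hk]
  have hcard2 := card_sq_add_one_eq_zero p hodd
  obtain ⟨h, hh⟩ := hodd
  have hm : 2 ≤ m := by omega
  have hh1 : 1 ≤ h := by have := hp.two_le; omega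
  have hmh : 2 * ((h : ℤ) + 1) ≤ m * (h + 1) := by gcongr
  have hD (i n : ℤ) (hi : i = 2 * n) (hn : -5 < n) :
      (Module.finrank ℂ (modFun ⊤ i) : ℤ) = dimFormula n := by
    rw [hi, finrank_modFun_top_eq_dimFormula hn]
  zify
  rw [hD (2 * m - 12 + 0) (m - 6) (by ring) (by omega),
    hD (2 * m - 12 + 2) (m - 5) (by ring) (by omega),
    hD (2 * m - 12 + 4) (m - 4) (by ring) (by omega),
    hD (2 * m - 12 + 6) (m - 3) (by ring) (by omega),
    hD (2 * m - 12 + 8) (m - 2) (by ring) (by omega),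
    hD (2 * m - 12 + 10) (m - 1) (by ring) (by omega),
    hD (m * (p + 1) - 12) (m * (h + 1) - 6) (by rw [hh]; push_cast; ring) (by omega),
    hD (m * (p + 1) - (p - 1) - 12) (m * (h + 1) - h - 6) (by rw [hh]; push_cast; ring) (by omega)]
  refine sum_mul_dimFormula
    (e₂ := (Finset.univ.filter fun j : ZMod p ↦ j ^ 2 + 1 = 0).card)
    (e₃ := (Finset.univ.filter fun j : ZMod p ↦ j ^ 2 + j + 1 = 0).card)
    (by zify at hsum; rw [hsum, hh]; push_cast; ring) (by exact_mod_cast h0)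
    (by exact_mod_cast h2) (by exact_mod_cast hi) (by exact_mod_cast hr)
    (by exact_mod_cast hr') ?_
  rw [hcard2]
  by_cases hp3 : p = 3
  · subst hp3
    rw [card_sq_add_self_add_one_eq_zero_three]
    norm_num
    omega
  · have : p % 3 ≠ 0 := fun h ↦ hp3
      ((Nat.prime_dvd_prime_iff_eq Nat.prime_three hp).1 (Nat.dvd_of_mod_eq_zero h)).symm
    rw [card_sq_add_self_add_one_eq_zero p hp3]
    have hmod : p % 4 = 1 ∨ p % 4 = 3 := by omega
    have hmod' : p % 3 = 1 ∨ p % 3 = 2 := by omega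
    have hp2 : (p : ℤ) = 2 * h + 1 := by exact_mod_cast hh
    obtain h₄ | h₄ := hmod <;> obtain h₃ | h₃ := hmod' <;> rw [h₄, h₃] <;> norm_num <;> omega
end
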